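/- Let α be a cone angle on ℝ^d and let P ⊂ ℝ^d be a d-dimensional belt polytope with lattice of flats L(P). Then for k = 0, …, d−1: (i) α̌_k(P) = W_k(L(P)); (ii) α̂_k(P) = (−1)^{d−k} w_{d−k}(L(P)^op) = |w_{d−k}(L(P)^op)|; and (iii) the generalized spherical intrinsic volume satisfies ᾱ_k(P) = (−1)^k w_k(L(P)) = |w_k(L(P))|. -/

import Mathlib

open scoped BigOperators InnerProductSpace Pointwise

noncomputable section

/-- Euclidean space `ℝ^d`. -/
abbrev Euc (d : ℕ) : Type := EuclideanSpace ℝ (Fin d)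

namespace GramAngles

variable {d : ℕ}

/-- The conical (positive) hull of a set. -/
def posHull (S : Set (Euc d)) : Set (Euc d) :=
  {u | ∃ c : ℝ, ∃ p ∈ S, 0 ≤ c ∧ u = c • p}

/-- The dimension of a set: the rank of the linear subspace parallel to its affine hull. -/
def sdim (S : Set (Euc d)) : ℕ := Module.finrank ℝ (vectorSpan ℝ S)

/-- A polyhedral cone with apex at the origin: a finitely generated convex cone. -/
def IsPolyhedralCone (C : Set (Euc d)) : Prop :=
  ∃ (n : ℕ) (v : Fin n → Euc d),
    C = {x | ∃ c : Fin n → ℝ, (∀ i, 0 ≤ c i) ∧ x = ∑ i, c i • v i}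

/-- A cone angle on `ℝ^d`: a simple, normalized valuation on polyhedral cones. -/
structure ConeAngle (d : ℕ) where
  toFun : Set (Euc d) → ℝ
  zero' : toFun {0} = 0
  union' : ∀ C C' : Set (Euc d), IsPolyhedralCone C → IsPolyhedralCone C' →
    IsPolyhedralCone (C ∪ C') → IsPolyhedralCone (C ∩ C') →
    toFun (C ∪ C') = toFun C + toFun C' - toFun (C ∩ C')
  simple' : ∀ C : Set (Euc d), IsPolyhedralCone C → sdim C < d → toFun C = 0
  norm' : toFun Set.univ = 1

/-- A (convex) polytope: the convex hull of a nonempty finite point set. -/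
def IsPolytope (P : Set (Euc d)) : Prop :=
  ∃ s : Finset (Euc d), s.Nonempty ∧ P = convexHull ℝ (s : Set (Euc d))

/-- Faces of a polytope are its exposed subsets (including `∅` and `P` itself). -/
def IsFace (P F : Set (Euc d)) : Prop := IsExposed ℝ P F

open Classical in
/-- A chosen point in the relative interior of `F`. -/
def relPt (F : Set (Euc d)) : Euc d :=
  if h : (intrinsicInterior ℝ F).Nonempty then h.some else 0

/-- The tangent (inner) cone `T_F G = cone(-q + G) + L(G)^⊥`, `q ∈ relint F`. -/
def innerCone (F G : Set (Euc d)) : Set (Euc d) :=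
  posHull ((fun x => x - relPt F) '' G) + (((vectorSpan ℝ G)ᗮ : Submodule ℝ (Euc d)) : Set (Euc d))

/-- The normal cone `N_F G` of `G` at a face `F`. -/
def normalCone (F G : Set (Euc d)) : Set (Euc d) :=
  {c | ∀ x ∈ F, ∀ y ∈ G, ⟪c, y⟫_ℝ ≤ ⟪c, x⟫_ℝ}

/-- The outer cone `O_F G = N_F G + L(F)`. -/
def outerCone (F G : Set (Euc d)) : Set (Euc d) :=
  normalCone F G + ((vectorSpan ℝ F : Submodule ℝ (Euc d)) : Set (Euc d))

/-- Interior angle of `G` at its face `F`, measured by the cone angle `α`. -/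
def intAngle (α : ConeAngle d) (F G : Set (Euc d)) : ℝ := α.toFun (innerCone F G)

/-- Exterior angle of `G` at its face `F`, measured by the cone angle `α`. -/
def extAngle (α : ConeAngle d) (F G : Set (Euc d)) : ℝ := α.toFun (outerCone F G)

/-- `α̂_i(P)`: sum of interior angles over all `i`-dimensional (nonempty) faces of `P`. -/
def intAngleSum (α : ConeAngle d) (P : Set (Euc d)) (i : ℕ) : ℝ :=
  ∑ᶠ F ∈ {F : Set (Euc d) | IsFace P F ∧ F.Nonempty ∧ sdim F = i}, intAngle α F P

/-- `α̌_i(P)`: sum of exterior angles over all `i`-dimensional (nonempty) faces of `P`. -/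
def extAngleSum (α : ConeAngle d) (P : Set (Euc d)) (i : ℕ) : ℝ :=
  ∑ᶠ F ∈ {F : Set (Euc d) | IsFace P F ∧ F.Nonempty ∧ sdim F = i}, extAngle α F P

/-- A zonotope: a translate of a Minkowski sum of finitely many segments. -/
def IsZonotope (Z : Set (Euc d)) : Prop :=
  ∃ (t : Euc d) (n : ℕ) (z : Fin n → Euc d),
    Z = {x | ∃ l : Fin n → ℝ, (∀ i, |l i| ≤ 1) ∧ x = t + ∑ i, l i • z i}

/-- The face of `P` on which the linear functional `⟪c, ·⟫` is maximized. -/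
def maxFace (P : Set (Euc d)) (c : Euc d) : Set (Euc d) :=
  {x ∈ P | ∀ y ∈ P, ⟪c, y⟫_ℝ ≤ ⟪c, x⟫_ℝ}

/-- A belt polytope: a polytope whose normal fan is the fan induced by a central
hyperplane arrangement (two functionals maximize the same face iff they have the
same sign pattern with respect to the arrangement). -/
def IsBeltPolytope (P : Set (Euc d)) : Prop :=
  IsPolytope P ∧ ∃ (k : ℕ) (z : Fin k → Euc d), (∀ i, z i ≠ 0) ∧
    ∀ c c' : Euc d,
      ((∀ i, Real.sign ⟪z i, c⟫_ℝ = Real.sign ⟪z i, c'⟫_ℝ) ↔ maxFace P c = maxFace P c')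

/-- The set of flats of a polytope: linear subspaces parallel to nonempty faces,
ordered by inclusion (as a subtype of `Submodule ℝ (Euc d)`). -/
def Flats (P : Set (Euc d)) : Set (Submodule ℝ (Euc d)) :=
  {L | ∃ F : Set (Euc d), IsFace P F ∧ F.Nonempty ∧ L = vectorSpan ℝ F}

/-- Strictly increasing chains from `a` to `c` in a poset, encoded as lists. -/
def chainsFromTo {β : Type*} [Preorder β] (a c : β) : Set (List β) :=
  {l | l.Chain' (· < ·) ∧ l.head? = some a ∧ l.getLast? = some c}

/-- The Möbius function of a poset, via Philip Hall's chain formula. -/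
def mob {β : Type*} [Preorder β] (a c : β) : ℝ :=
  ∑ᶠ l ∈ chainsFromTo a c, (-1 : ℝ) ^ (l.length + 1)

/-- Whitney numbers of the first kind of a ranked poset with minimum `bot`. -/
def whitney1 {β : Type*} [Preorder β] (rk : β → ℕ) (bot : β) (i : ℕ) : ℝ :=
  ∑ᶠ a ∈ {a : β | rk a = i}, mob bot a

/-- Flag-Whitney numbers of the second kind: the number of chains with rank set `S`. -/
def flagW2 {β : Type*} [Preorder β] (rk : β → ℕ) (S : Finset ℕ) : ℕ :=
  Nat.card {l : List β // l.Chain' (· < ·) ∧ l.map rk = S.sort (· ≤ ·)}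

/-- Flag-Whitney numbers of the first kind:
`w_S = Σ μ(0̂,c₁) μ(c₁,c₂) ⋯ μ(c_{k-1},c_k)` over chains with rank set `S`. -/
def flagW1 {β : Type*} [Preorder β] (rk : β → ℕ) (bot : β) (S : Finset ℕ) : ℝ :=
  ∑ᶠ l ∈ {l : List β | l.Chain' (· < ·) ∧ l.map rk = S.sort (· ≤ ·)},
    (List.zipWith mob (bot :: l) l).prod

/-- Chains of nonempty faces of `P` whose dimensions are exactly the set `S`. -/
def faceChains (P : Set (Euc d)) (S : Finset ℕ) : Set (List (Set (Euc d))) :=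
  {l | (∀ F ∈ l, IsFace P F ∧ F.Nonempty) ∧ l.Chain' (· ⊂ ·) ∧ l.map sdim = S.sort (· ≤ ·)}

/-- The interior flag-angle `α̂_S(P) = Σ α̂(F₁,F₂) α̂(F₂,F₃) ⋯ α̂(F_k,P)`. -/
def intFlag (α : ConeAngle d) (P : Set (Euc d)) (S : Finset ℕ) : ℝ :=
  ∑ᶠ l ∈ faceChains P S, (List.zipWith (intAngle α) l (l.drop 1 ++ [P])).prod

/-- The exterior flag-angle `α̌_S(P) = Σ α̌(F₁,F₂) α̌(F₂,F₃) ⋯ α̌(F_k,P)`. -/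
def extFlag (α : ConeAngle d) (P : Set (Euc d)) (S : Finset ℕ) : ℝ :=
  ∑ᶠ l ∈ faceChains P S, (List.zipWith (extAngle α) l (l.drop 1 ++ [P])).prod

/-- Membership in the incidence algebra: vanishing off the order relation. -/
def memIA {β : Type*} [Preorder β] (h : β → β → ℝ) : Prop :=
  ∀ a c, ¬ a ≤ c → h a c = 0

/-- Convolution product of the incidence algebra. -/
def conv {β : Type*} [Preorder β] (g h : β → β → ℝ) (a c : β) : ℝ :=
  ∑ᶠ (b : β) (_ : a ≤ b ∧ b ≤ c), g a b * h b c

/-- The product `∗_k`, summing over middle elements of rank `k`. -/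
def convk {β : Type*} (rk : β → ℕ) (k : ℕ) (g h : β → β → ℝ) (a c : β) : ℝ :=
  ∑ᶠ (b : β) (_ : rk b = k), g a b * h b c

/-- The pushforward `φ_* h (q,q') = |φ⁻¹(q')|⁻¹ Σ_{p ∈ φ⁻¹(q), p' ∈ φ⁻¹(q')} h(p,p')`. -/
def pushf {β γ : Type*} (φ : β → γ) (h : β → β → ℝ) (q q' : γ) : ℝ :=
  (Nat.card {p : β // φ p = q'} : ℝ)⁻¹ *
    ∑ᶠ (p : β) (_ : φ p = q) (p' : β) (_ : φ p' = q'), h p p'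

/-- The subspace `I_φ(𝒫)`: elements whose fiberwise column sums are independent of
the representative of the target fiber. -/
def memIphi {β γ : Type*} [Preorder β] (φ : β → γ) (h : β → β → ℝ) : Prop :=
  memIA h ∧ ∀ (q : γ) (p₁ p₂ : β), φ p₁ = φ p₂ →
    (∑ᶠ (p : β) (_ : φ p = q), h p p₁) = (∑ᶠ (p : β) (_ : φ p = q), h p p₂)

open Classical in
/-- The pullback `φ^* g (p,p') = g(φ p, φ p')` for `p ≤ p'`, else `0`. -/
def pullb {β γ : Type*} [Preorder β] (φ : β → γ) (g : γ → γ → ℝ) (p p' : β) : ℝ :=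
  if p ≤ p' then g (φ p) (φ p') else 0

open Classical in
/-- The identity `δ` of the incidence algebra. -/
def deltaIA {β : Type*} (a c : β) : ℝ := if a = c then 1 else 0

end GramAngles

namespace GramAngles

/-- The generalized `k`-th spherical intrinsic volume
`ᾱ_k(P) = Σ α̂(v,F) α̌(F,P)` over pairs of a vertex `v ∈ P` and a `k`-face `F ∋ v`. -/
def sphVol {d : ℕ} (α : ConeAngle d) (P : Set (Euc d)) (k : ℕ) : ℝ :=
  ∑ᶠ p ∈ {p : Euc d × Set (Euc d) | IsFace P {p.1} ∧ IsFace P p.2 ∧ p.2.Nonempty ∧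
      sdim p.2 = k ∧ p.1 ∈ p.2},
    intAngle α {p.1} p.2 * extAngle α p.2 P


section Part1
variable {d : ℕ}

/-- The cone generated by a finite family. -/
def vCone {ι : Type} [Fintype ι] (v : ι → Euc d) : Set (Euc d) :=
  {x | ∃ c : ι → ℝ, (∀ i, 0 ≤ c i) ∧ x = ∑ i, c i • v i}

/-- The cone cut out by a finite set of halfspaces. -/
def hCone (T : Finset (Euc d)) : Set (Euc d) := {x | ∀ t ∈ T, 0 ≤ ⟪t, x⟫_ℝ}

theorem vCone_poly {ι : Type} [Fintype ι] (v : ι → Euc d) : IsPolyhedralCone (vCone v) := by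
  refine ⟨Fintype.card ι, fun j => v ((Fintype.equivFin ι).symm j), ?_⟩
  ext x
  constructor
  · rintro ⟨c, hc, rfl⟩
    refine ⟨fun j => c ((Fintype.equivFin ι).symm j), fun j => hc _, ?_⟩
    exact (Equiv.sum_comp (Fintype.equivFin ι).symm (fun i => c i • v i)).symm
  · rintro ⟨c, hc, rfl⟩
    refine ⟨fun j => c (Fintype.equivFin ι j), fun j => hc _, ?_⟩
    rw [← Equiv.sum_comp (Fintype.equivFin ι).symm]
    simp

theorem dd_step {ι : Type} [Fintype ι] (v : ι → Euc d) (a : Euc d) :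
    ∃ w : ι ⊕ (ι × ι) → Euc d, vCone v ∩ {x | 0 ≤ ⟪a, x⟫_ℝ} = vCone w := by
  classical
  set p : ι → ℝ := fun i => ⟪a, v i⟫_ℝ with hp
  refine ⟨Sum.elim (fun i => if 0 ≤ p i then v i else 0)
    (fun ij => if 0 < p ij.1 ∧ p ij.2 < 0 then p ij.1 • v ij.2 - p ij.2 • v ij.1 else 0), ?_⟩
  ext x
  constructor
  · rintro ⟨⟨c, hc, rfl⟩, hx⟩
    have hx' : 0 ≤ ∑ i, c i * p i := by
      simpa [inner_sum, inner_smul_right, hp] using hx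
    set A := ∑ i, if 0 < p i then c i * p i else 0 with hA
    set B := ∑ i, if p i < 0 then c i * (- p i) else 0 with hB
    have hAB : ∑ i, c i * p i = A - B := by
      rw [hA, hB, ← Finset.sum_sub_distrib]
      refine Finset.sum_congr rfl fun i _ => ?_
      rcases lt_trichotomy (p i) 0 with h | h | h
      · simp [h, h.le, not_lt.2 h.le]
      · simp [h]
      · simp [h, not_lt.2 h.le]
    have hA0 : 0 ≤ A := Finset.sum_nonneg fun i _ => by
      split_ifs with h
      · exact mul_nonneg (hc i) h.le
      · exact le_rfl
    have hBn : ∀ i, 0 ≤ (if p i < 0 then c i * (- p i) else 0) := fun i => by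
      split_ifs with h
      · exact mul_nonneg (hc i) (by linarith)
      · exact le_rfl
    have hB0 : 0 ≤ B := Finset.sum_nonneg fun i _ => hBn i
    have hBA : B ≤ A := by linarith
    rcases hA0.eq_or_lt with hA1 | hA1
    · have hB1 : B = 0 := by linarith
      have hz := (Finset.sum_eq_zero_iff_of_nonneg (fun i _ => hBn i)).1 (hB ▸ hB1)
      have hz' : ∀ i, p i < 0 → c i = 0 := by
        intro i hi
        have := hz i (Finset.mem_univ i)
        rw [if_pos hi] at this
        rcases mul_eq_zero.1 this with h | h
        · exact h
        · linarith
      refine ⟨Sum.elim c (fun _ => 0), ?_, ?_⟩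
      · rintro (i | i) <;> simp [hc]
      · simp only [Fintype.sum_sum_type, Sum.elim_inl, Sum.elim_inr, zero_smul,
          Finset.sum_const_zero, add_zero]
        refine Finset.sum_congr rfl fun i _ => ?_
        split_ifs with h
        · rfl
        · simp [hz' i (not_le.1 h)]
    · refine ⟨Sum.elim (fun i => if 0 < p i then (1 - B / A) * c i else c i)
        (fun ij => c ij.1 * c ij.2 / A), ?_, ?_⟩
      · rintro (i | ij)
        · simp only [Sum.elim_inl]
          split_ifs
          · refine mul_nonneg ?_ (hc i)
            rw [sub_nonneg, div_le_one hA1]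
            exact hBA
          · exact hc i
        · exact div_nonneg (mul_nonneg (hc _) (hc _)) hA1.le
      · simp only [Fintype.sum_sum_type, Sum.elim_inl, Sum.elim_inr]
        have key : ∑ ij : ι × ι, (c ij.1 * c ij.2 / A) •
            (if 0 < p ij.1 ∧ p ij.2 < 0 then p ij.1 • v ij.2 - p ij.2 • v ij.1 else 0)
            = (∑ j, if p j < 0 then c j • v j else 0)
              + (B / A) • ∑ i, (if 0 < p i then c i • v i else 0) := by
          have h1 : ∀ ij : ι × ι, (c ij.1 * c ij.2 / A) •
            (if 0 < p ij.1 ∧ p ij.2 < 0 then p ij.1 • v ij.2 - p ij.2 • v ij.1 else 0)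
            = ((1 / A) * (if 0 < p ij.1 then c ij.1 * p ij.1 else 0)) •
                (if p ij.2 < 0 then c ij.2 • v ij.2 else 0)
              + ((1 / A) * (if p ij.2 < 0 then c ij.2 * (-p ij.2) else 0)) •
                (if 0 < p ij.1 then c ij.1 • v ij.1 else 0) := by
            intro ij
            by_cases h1 : 0 < p ij.1 <;> by_cases h2 : p ij.2 < 0
            · simp only [h1, h2, and_self, if_true, smul_sub, smul_smul]
              rw [sub_eq_add_neg, ← neg_smul]
              congr 2 <;> ring
            all_goals simp [h1, h2]
          rw [Finset.sum_congr rfl (fun ij _ => h1 ij), Finset.sum_add_distrib,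
            Fintype.sum_prod_type, Fintype.sum_prod_type_right]
          congr 1
          · simp only
            simp_rw [← Finset.smul_sum]
            rw [← Finset.sum_smul, ← Finset.mul_sum, ← hA, one_div_mul_cancel hA1.ne', one_smul]
          · simp only
            simp_rw [← Finset.smul_sum]
            rw [← Finset.sum_smul, ← Finset.mul_sum, ← hB]
            congr 1
            ring
        rw [key, Finset.smul_sum, ← Finset.sum_add_distrib, ← Finset.sum_add_distrib]
        refine Finset.sum_congr rfl fun i _ => ?_
        rcases lt_trichotomy (p i) 0 with h | h | h
        · simp [h, not_lt.2 h.le, not_le.2 h]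
        · simp [h]
        · simp only [h, h.le, not_lt.2 h.le, if_true, if_false, zero_add]
          rw [smul_smul, ← add_smul]
          congr 1
          ring
  · rintro ⟨c, hc, rfl⟩
    constructor
    · refine ⟨fun i => (if 0 ≤ p i then c (Sum.inl i) else 0)
        + (∑ j, if 0 < p j ∧ p i < 0 then c (Sum.inr (j, i)) * p j else 0)
        + (∑ j, if 0 < p i ∧ p j < 0 then c (Sum.inr (i, j)) * (- p j) else 0), ?_, ?_⟩
      · intro i
        refine add_nonneg (add_nonneg ?_ ?_) ?_
        · split_ifs <;> simp [hc]
        · refine Finset.sum_nonneg fun j _ => ?_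
          split_ifs with h
          · exact mul_nonneg (hc _) h.1.le
          · exact le_rfl
        · refine Finset.sum_nonneg fun j _ => ?_
          split_ifs with h
          · exact mul_nonneg (hc _) (by linarith [h.2])
          · exact le_rfl
      · simp only [Fintype.sum_sum_type, Sum.elim_inl, Sum.elim_inr, add_smul,
          Finset.sum_add_distrib, add_assoc]
        congr 1
        · refine Finset.sum_congr rfl fun i _ => ?_
          split_ifs <;> simp
        · simp_rw [Finset.sum_smul]
          rw [Finset.sum_comm (f := fun i j => (if 0 < p j ∧ p i < 0 then
            c (Sum.inr (j, i)) * p j else 0) • v i), ← Finset.sum_add_distrib,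
            Fintype.sum_prod_type]
          refine Finset.sum_congr rfl fun i _ => ?_
          rw [← Finset.sum_add_distrib]
          refine Finset.sum_congr rfl fun j _ => ?_
          split_ifs
          · rw [smul_sub, smul_smul, smul_smul, sub_eq_add_neg, ← neg_smul]
            congr 2
            ring
          · simp
    · show 0 ≤ ⟪a, _⟫_ℝ
      rw [inner_sum]
      refine Finset.sum_nonneg fun i _ => ?_
      rw [inner_smul_right]
      refine mul_nonneg (hc i) ?_
      rcases i with i | ij
      · simp only [Sum.elim_inl]
        split_ifs with h
        · exact h
        · simp
      · simp only [Sum.elim_inr]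
        split_ifs with h
        · rw [inner_sub_right, inner_smul_right, inner_smul_right]
          have : p ij.1 * p ij.2 - p ij.2 * p ij.1 = 0 := by ring
          exact this.ge
        · simp

theorem univ_vCone : ∃ (ι : Type) (_ : Fintype ι) (v : ι → Euc d), vCone v = Set.univ := by
  refine ⟨Fin d ⊕ Fin d, inferInstance, Sum.elim (fun i => EuclideanSpace.single i 1)
    (fun i => - EuclideanSpace.single i 1), ?_⟩
  refine Set.eq_univ_of_forall fun x => ?_
  refine ⟨Sum.elim (fun i => max (x i) 0) (fun i => max (- x i) 0), ?_, ?_⟩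
  · rintro (i | i) <;> simp
  · simp only [Fintype.sum_sum_type, Sum.elim_inl, Sum.elim_inr, smul_neg]
    rw [← Finset.sum_add_distrib]
    ext j
    simp [Finset.sum_apply, EuclideanSpace.single_apply, Finset.sum_add_distrib]
    simp only [Pi.single_apply, mul_ite, mul_one, mul_zero, Finset.sum_ite_eq, Finset.mem_univ,
      if_true]
    rcases le_total (x j) 0 with h | h
    · rw [max_eq_right h, max_eq_left (by linarith)]; ring
    · rw [max_eq_left h, max_eq_right (by linarith)]; ring

theorem hCone_v (T : Finset (Euc d)) :
    ∃ (ι : Type) (_ : Fintype ι) (v : ι → Euc d), hCone T = vCone v := by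
  classical
  induction T using Finset.induction_on with
  | empty =>
    obtain ⟨ι, h, v, hv⟩ := univ_vCone (d := d)
    exact ⟨ι, h, v, by rw [hv]; simp [hCone]⟩
  | insert a T _ ih =>
    obtain ⟨ι, h, v, hv⟩ := ih
    obtain ⟨w, hw⟩ := dd_step v a
    refine ⟨_, inferInstance, w, ?_⟩
    rw [← hw, ← hv]
    ext x
    simp [hCone, and_comm]

theorem hCone_poly (T : Finset (Euc d)) : IsPolyhedralCone (hCone T) := by
  obtain ⟨ι, h, v, hv⟩ := hCone_v T
  rw [hv]; exact vCone_poly v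

theorem between {ι κ : Type*} (s : Finset ι) (t : Finset κ) (f : ι → ℝ) (g : κ → ℝ)
    (h : ∀ i ∈ s, ∀ j ∈ t, f i ≤ g j) : ∃ r, (∀ i ∈ s, f i ≤ r) ∧ ∀ j ∈ t, r ≤ g j := by
  rcases s.eq_empty_or_nonempty with rfl | hs
  · rcases t.eq_empty_or_nonempty with rfl | ht
    · exact ⟨0, by simp, by simp⟩
    · exact ⟨t.inf' ht g, by simp, fun j hj => Finset.inf'_le _ hj⟩
  · exact ⟨s.sup' hs f, fun i hi => Finset.le_sup' _ hi, fun j hj =>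
      Finset.sup'_le _ _ fun i hi => h i hi j hj⟩

theorem fm_step (T : Finset (Euc d)) (v : Euc d) :
    ∃ T' : Finset (Euc d), hCone T' = {y | ∃ t : ℝ, 0 ≤ t ∧ y - t • v ∈ hCone T} := by
  classical
  refine ⟨(T.filter fun a => 0 ≤ ⟪a, v⟫_ℝ) ∪
    (((T.filter fun a => 0 < ⟪a, v⟫_ℝ) ×ˢ (T.filter fun a => ⟪a, v⟫_ℝ < 0)).image
      fun ab => ⟪ab.1, v⟫_ℝ • ab.2 - ⟪ab.2, v⟫_ℝ • ab.1), ?_⟩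
  ext y
  constructor
  · intro hy
    have h1 : ∀ a ∈ T, 0 ≤ ⟪a, v⟫_ℝ → 0 ≤ ⟪a, y⟫_ℝ := fun a ha h =>
      hy a (Finset.mem_union_left _ (by simp [ha, h]))
    have h2 : ∀ a ∈ T, 0 < ⟪a, v⟫_ℝ → ∀ b ∈ T, ⟪b, v⟫_ℝ < 0 →
        0 ≤ ⟪a, v⟫_ℝ * ⟪b, y⟫_ℝ - ⟪b, v⟫_ℝ * ⟪a, y⟫_ℝ := by
      intro a ha h b hb h'
      have := hy (⟪a, v⟫_ℝ • b - ⟪b, v⟫_ℝ • a) (Finset.mem_union_right _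
        (Finset.mem_image.2 ⟨(a, b), by simp [ha, hb, h, h'], rfl⟩))
      rwa [inner_sub_left, real_inner_smul_left, real_inner_smul_left] at this
    obtain ⟨r, hr1, hr2⟩ := between (Finset.insertNone (T.filter fun a => ⟪a, v⟫_ℝ < 0))
      (T.filter fun a => 0 < ⟪a, v⟫_ℝ)
      (fun o : Option (Euc d) => o.elim 0 fun b => ⟪b, y⟫_ℝ / ⟪b, v⟫_ℝ) (fun a => ⟪a, y⟫_ℝ / ⟪a, v⟫_ℝ) (by
        intro o ho a ha
        simp only [Finset.mem_filter] at ha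
        cases o with
        | none => exact div_nonneg (h1 a ha.1 ha.2.le) ha.2.le
        | some b =>
          simp only [Finset.some_mem_insertNone, Finset.mem_filter] at ho
          simp only [Option.elim]
          have := h2 a ha.1 ha.2 b ho.1 ho.2
          rw [le_div_iff₀ ha.2, div_mul_eq_mul_div, div_le_iff_of_neg ho.2]
          linarith)
    refine ⟨r, by simpa using hr1 none (by simp), ?_⟩
    intro a ha
    rw [inner_sub_right, inner_smul_right, sub_nonneg]
    rcases lt_trichotomy ⟪a, v⟫_ℝ 0 with h | h | h
    · have := hr1 (some a) (by simp [ha, h])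
      simp only [Option.elim] at this
      rwa [div_le_iff_of_neg h] at this
    · rw [h, mul_zero]; exact h1 a ha h.ge
    · have := hr2 a (by simp [ha, h])
      rwa [le_div_iff₀ h] at this
  · rintro ⟨t, ht, hy⟩
    have hk : ∀ a ∈ T, t * ⟪a, v⟫_ℝ ≤ ⟪a, y⟫_ℝ := by
      intro a ha
      have := hy a ha
      rwa [inner_sub_right, inner_smul_right, sub_nonneg] at this
    intro a ha
    rcases Finset.mem_union.1 ha with ha | ha
    · simp only [Finset.mem_filter] at ha
      exact (mul_nonneg ht ha.2).trans (hk a ha.1)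
    · obtain ⟨⟨a, b⟩, hab, rfl⟩ := Finset.mem_image.1 ha
      simp only [Finset.mem_product, Finset.mem_filter] at hab
      obtain ⟨⟨ha1, ha2⟩, hb1, hb2⟩ := hab
      simp only
      rw [inner_sub_left, real_inner_smul_left, real_inner_smul_left]
      have h1 := hk a ha1
      have h2 := hk b hb1
      nlinarith

theorem vCone_h (n : ℕ) : ∀ v : Fin n → Euc d, ∃ T : Finset (Euc d), vCone v = hCone T := by
  classical
  induction n with
  | zero =>
    intro v
    refine ⟨(Finset.univ.image fun i : Fin d => EuclideanSpace.single i (1:ℝ)) ∪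
      (Finset.univ.image fun i : Fin d => - EuclideanSpace.single i (1:ℝ)), ?_⟩
    ext x
    constructor
    · rintro ⟨c, hc, rfl⟩
      intro t _; simp
    · intro hx
      refine ⟨fun _ => 0, by simp, ?_⟩
      simp only [Finset.univ_eq_empty, Finset.sum_empty]
      ext i
      have h1 := hx (EuclideanSpace.single i (1:ℝ)) (by simp)
      have h2 := hx (-EuclideanSpace.single i (1:ℝ)) (by simp)
      rw [inner_neg_left, EuclideanSpace.inner_single_left] at h2
      rw [EuclideanSpace.inner_single_left] at h1
      simp at h1 h2 ⊢
      linarith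
  | succ n ih =>
    intro v
    obtain ⟨T, hT⟩ := ih (fun i => v i.succ)
    obtain ⟨T', hT'⟩ := fm_step T (v 0)
    refine ⟨T', ?_⟩
    rw [hT', ← hT]
    ext x
    constructor
    · rintro ⟨c, hc, rfl⟩
      refine ⟨c 0, hc 0, fun i => c i.succ, fun i => hc _, ?_⟩
      rw [Fin.sum_univ_succ]; simp
    · rintro ⟨t, ht, c, hc, h⟩
      refine ⟨Fin.cons t c, ?_, ?_⟩
      · intro i; refine Fin.cases ?_ ?_ i <;> simp [ht, hc]
      · rw [Fin.sum_univ_succ]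
        simp [← h]

theorem poly_h {C : Set (Euc d)} (hC : IsPolyhedralCone C) : ∃ T : Finset (Euc d), C = hCone T := by
  obtain ⟨n, v, rfl⟩ := hC
  exact vCone_h n v

theorem sdim_lt_of_subset {C : Set (Euc d)} {a : Euc d} (ha : a ≠ 0)
    (h : ∀ x ∈ C, ⟪a, x⟫_ℝ = 0) : sdim C < d := by
  have h1 : vectorSpan ℝ C ≤ (ℝ ∙ a)ᗮ := by
    rw [vectorSpan_def, Submodule.span_le]
    rintro _ ⟨x, hx, y, hy, rfl⟩
    rw [SetLike.mem_coe, Submodule.mem_orthogonal_singleton_iff_inner_right]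
    simp [inner_sub_right, h x hx, h y hy]
  have h2 := Submodule.finrank_mono h1
  have h3 := (ℝ ∙ a).finrank_add_finrank_orthogonal
  rw [finrank_span_singleton ha, finrank_euclideanSpace_fin] at h3
  unfold sdim
  omega

theorem hCone_convex (T : Finset (Euc d)) : Convex ℝ (hCone T) := by
  intro x hx y hy a b ha hb _ t ht
  rw [inner_add_right, inner_smul_right, inner_smul_right]
  exact add_nonneg (mul_nonneg ha (hx t ht)) (mul_nonneg hb (hy t ht))

theorem sdim_lt_of_interior (T : Finset (Euc d)) (h : interior (hCone T) = ∅) :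
    sdim (hCone T) < d := by
  by_contra hlt
  have h1 : vectorSpan ℝ (hCone T) = ⊤ := by
    apply Submodule.eq_top_of_finrank_eq
    rw [finrank_euclideanSpace_fin]
    refine le_antisymm ?_ (not_lt.1 hlt)
    have := Submodule.finrank_le (vectorSpan ℝ (hCone T))
    rwa [finrank_euclideanSpace_fin] at this
  have hne : (hCone T).Nonempty := ⟨0, fun t _ => by simp⟩
  rw [← AffineSubspace.affineSpan_eq_top_iff_vectorSpan_eq_top_of_nonempty ℝ _ _ hne] at h1
  rw [← (hCone_convex T).interior_nonempty_iff_affineSpan_eq_top, h] at h1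
  simp at h1

theorem inner_pos_of_interior {D : Set (Euc d)} {a x : Euc d} (ha : a ≠ 0)
    (hD : ∀ y ∈ D, 0 ≤ ⟪a, y⟫_ℝ) (hx : x ∈ interior D) : 0 < ⟪a, x⟫_ℝ := by
  have h1 : Filter.Tendsto (fun t : ℝ => x - t • a) (nhdsWithin 0 (Set.Ioi 0)) (nhds x) := by
    have : ContinuousAt (fun t : ℝ => x - t • a) 0 := by fun_prop
    have h := this.tendsto
    simp only [zero_smul, sub_zero] at h
    exact h.mono_left nhdsWithin_le_nhds
  have h2 := h1.eventually (mem_interior_iff_mem_nhds.1 hx)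
  obtain ⟨t, ht, htp⟩ := (h2.and self_mem_nhdsWithin).exists
  have h3 := hD _ ht
  rw [inner_sub_right, inner_smul_right] at h3
  have h4 : 0 < ⟪a, a⟫_ℝ := real_inner_self_pos.2 ha
  have : 0 < t * ⟪a, a⟫_ℝ := mul_pos htp h4
  linarith

theorem angle_split (α : ConeAngle d) (T : Finset (Euc d)) (a : Euc d) (ha : a ≠ 0) :
    α.toFun (hCone T) = α.toFun (hCone T ∩ {x | 0 ≤ ⟪a, x⟫_ℝ})
      + α.toFun (hCone T ∩ {x | 0 ≤ ⟪-a, x⟫_ℝ}) := by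
  classical
  have e : ∀ b : Euc d, hCone T ∩ {x | 0 ≤ ⟪b, x⟫_ℝ} = hCone (insert b T) := by
    intro b; ext x; simp [hCone, and_comm]
  have hu : (hCone T ∩ {x | 0 ≤ ⟪a, x⟫_ℝ}) ∪ (hCone T ∩ {x | 0 ≤ ⟪-a, x⟫_ℝ}) = hCone T := by
    rw [← Set.inter_union_distrib_left, Set.inter_eq_left]
    intro x _
    simp only [Set.mem_union, Set.mem_setOf_eq, inner_neg_left]
    rcases le_total 0 ⟪a, x⟫_ℝ with h | h
    · left; exact h
    · right; linarith
  have hi : (hCone T ∩ {x | 0 ≤ ⟪a, x⟫_ℝ}) ∩ (hCone T ∩ {x | 0 ≤ ⟪-a, x⟫_ℝ})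
      = hCone (insert a (insert (-a) T)) := by
    ext x; simp [hCone]; tauto
  have := α.union' (hCone T ∩ {x | 0 ≤ ⟪a, x⟫_ℝ}) (hCone T ∩ {x | 0 ≤ ⟪-a, x⟫_ℝ})
    (by rw [e]; exact hCone_poly _) (by rw [e]; exact hCone_poly _)
    (by rw [hu]; exact hCone_poly _) (by rw [hi]; exact hCone_poly _)
  rw [hu, hi] at this
  rw [this, α.simple' _ (hCone_poly _), sub_zero]
  refine sdim_lt_of_subset ha fun x hx => ?_
  have h1 := hx a (by simp)
  have h2 := hx (-a) (by simp)
  rw [inner_neg_left] at h2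
  linarith

open Classical in
theorem additivity_aux (α : ConeAngle d) {J : Type*} (s : Finset J) (T : J → Finset (Euc d))
    (N : ℝ) (all : Finset (Euc d)) (h0 : ∀ a ∈ all, a ≠ 0)
    (hT : ∀ j ∈ s, ∀ t ∈ T j, t ≠ 0 → t ∈ all)
    (h : ∀ x, (∀ b ∈ all, ⟪b, x⟫_ℝ ≠ 0) → ((s.filter fun j => x ∈ hCone (T j)).card : ℝ) = N)
    (A : Finset (Euc d)) : A ⊆ all → ∀ D : Finset (Euc d),
    (∀ a ∈ all, a ∈ A ∨ (∀ x ∈ hCone D, 0 ≤ ⟪a, x⟫_ℝ) ∨ (∀ x ∈ hCone D, 0 ≤ ⟪-a, x⟫_ℝ)) →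
    ∑ j ∈ s, α.toFun (hCone (T j) ∩ hCone D) = N * α.toFun (hCone D) := by
  have hin : ∀ D E : Finset (Euc d), hCone D ∩ hCone E = hCone (D ∪ E) := by
    intro D E; ext x; simp only [hCone, Set.mem_inter_iff, Set.mem_setOf_eq, Finset.mem_union]
    constructor
    · rintro ⟨h1, h2⟩ t (ht | ht)
      · exact h1 t ht
      · exact h2 t ht
    · intro h; exact ⟨fun t ht => h t (Or.inl ht), fun t ht => h t (Or.inr ht)⟩
  induction A using Finset.induction_on with
  | empty =>
    intro _ D hD
    simp only [Finset.notMem_empty, false_or] at hD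
    rcases (interior (hCone D)).eq_empty_or_nonempty with he | ⟨x, hx⟩
    · have hlt := sdim_lt_of_interior D he
      rw [α.simple' _ (hCone_poly _) hlt, mul_zero]
      refine Finset.sum_eq_zero fun j _ => ?_
      rw [hin]
      refine α.simple' _ (hCone_poly _) (lt_of_le_of_lt ?_ hlt)
      refine Submodule.finrank_mono (vectorSpan_mono ℝ ?_)
      rw [← hin]; exact Set.inter_subset_right
    · have hne : ∀ b ∈ all, ⟪b, x⟫_ℝ ≠ 0 := by
        intro b hb
        rcases hD b hb with h1 | h1
        · exact (inner_pos_of_interior (h0 b hb) h1 hx).ne'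
        · have := inner_pos_of_interior (neg_ne_zero.2 (h0 b hb)) h1 hx
          rw [inner_neg_left] at this
          linarith
      rw [← h x hne, Finset.card_filter, Nat.cast_sum, Finset.sum_mul]
      refine Finset.sum_congr rfl fun j hj => ?_
      split_ifs with hxj
      · rw [Nat.cast_one, one_mul, Set.inter_eq_right.2]
        intro y hy t ht
        by_cases ht0 : t = 0
        · simp [ht0]
        have hta := hT j hj t ht ht0
        rcases hD t hta with h1 | h1
        · exact h1 y hy
        · have h2 := inner_pos_of_interior (neg_ne_zero.2 ht0) h1 hx
          rw [inner_neg_left] at h2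
          have := hxj t ht
          linarith
      · rw [Nat.cast_zero, zero_mul, hin]
        simp only [hCone, Set.mem_setOf_eq, not_forall, not_le] at hxj
        obtain ⟨t, ht, hlt⟩ := hxj
        have ht0 : t ≠ 0 := by rintro rfl; simp at hlt
        refine α.simple' _ (hCone_poly _) (sdim_lt_of_subset ht0 fun y hy => ?_)
        rw [← hin] at hy
        have h3 := hy.1 t ht
        rcases hD t (hT j hj t ht ht0) with h1 | h1
        · have h2 := inner_pos_of_interior ht0 h1 hx
          linarith
        · have := h1 y hy.2
          rw [inner_neg_left] at this
          linarith
  | insert a A _ ih =>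
    intro hA D hD
    have ha : a ∈ all := hA (by simp)
    have e : ∀ (b : Euc d) (E : Finset (Euc d)),
        hCone E ∩ {x | 0 ≤ ⟪b, x⟫_ℝ} = hCone (insert b E) := by
      intro b E; ext x; simp [hCone, and_comm]
    have step : ∀ b : Euc d, (b = a ∨ b = -a) → ∑ j ∈ s, α.toFun (hCone (T j) ∩ hCone (insert b D))
        = N * α.toFun (hCone (insert b D)) := by
      intro b hb
      refine ih (fun y hy => hA (Finset.mem_insert_of_mem hy)) _ ?_
      intro a' ha'
      have hsub : ∀ x ∈ hCone (insert b D), x ∈ hCone D := fun x hx t ht =>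
        hx t (Finset.mem_insert_of_mem ht)
      rcases hD a' ha' with h1 | h1 | h1
      · rcases Finset.mem_insert.1 h1 with rfl | h1
        · right
          rcases hb with rfl | rfl
          · left; intro x hx; exact hx _ (by simp)
          · right; intro x hx; exact hx _ (by simp)
        · exact Or.inl h1
      · exact Or.inr (Or.inl fun x hx => h1 x (hsub x hx))
      · exact Or.inr (Or.inr fun x hx => h1 x (hsub x hx))
    rw [angle_split α D a (h0 a ha), e, e, mul_add, ← step a (Or.inl rfl), ← step (-a) (Or.inr rfl),
      ← Finset.sum_add_distrib]
    refine Finset.sum_congr rfl fun j _ => ?_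
    rw [hin, angle_split α _ a (h0 a ha), e, e, hin, hin, Finset.union_insert, Finset.union_insert]

open Classical in
/-- Pointwise counting for generic points determines angle sums. -/
theorem additivity (α : ConeAngle d) {J : Type*} (s : Finset J) (C : J → Set (Euc d))
    (hC : ∀ j ∈ s, IsPolyhedralCone (C j))
    (N : ℝ) (bad : Finset (Euc d)) (h0 : ∀ a ∈ bad, a ≠ 0)
    (h : ∀ x, (∀ b ∈ bad, ⟪b, x⟫_ℝ ≠ 0) → ((s.filter fun j => x ∈ C j).card : ℝ) = N) :
    ∑ j ∈ s, α.toFun (C j) = N := by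
  have hex : ∀ j, ∃ T : Finset (Euc d), j ∈ s → C j = hCone T := by
    intro j
    by_cases hj : j ∈ s
    · obtain ⟨T, hT⟩ := poly_h (hC j hj)
      exact ⟨T, fun _ => hT⟩
    · exact ⟨∅, fun h => absurd h hj⟩
  choose T hT using hex
  have hu : hCone (∅ : Finset (Euc d)) = Set.univ := by simp [hCone]
  have := additivity_aux α s T N (bad ∪ (s.biUnion T).filter (· ≠ 0)) (by
      intro a ha
      rcases Finset.mem_union.1 ha with ha | ha
      · exact h0 a ha
      · exact (Finset.mem_filter.1 ha).2) (by
      intro j hj t ht ht0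
      exact Finset.mem_union_right _ (Finset.mem_filter.2 ⟨Finset.mem_biUnion.2 ⟨j, hj, ht⟩, ht0⟩)) (by
      intro x hx
      rw [← h x fun b hb => hx b (Finset.mem_union_left _ hb)]
      congr 2
      refine Finset.filter_congr fun j hj => ?_
      rw [hT j hj]) _ (Finset.Subset.refl _) ∅ (fun a ha => Or.inl ha)
  rw [hu, α.norm', mul_one] at this
  rw [← this]
  refine Finset.sum_congr rfl fun j hj => ?_
  rw [Set.inter_univ, hT j hj]

theorem exists_generic (bad : Finset (Euc d)) (h0 : ∀ a ∈ bad, a ≠ 0) :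
    ∃ x : Euc d, ∀ b ∈ bad, ⟪b, x⟫_ℝ ≠ 0 := by
  classical
  have := Subspace.biUnion_ne_univ_of_top_notMem (k := ℝ) (E := Euc d)
    (s := bad.image fun b => (ℝ ∙ b)ᗮ) (by
      intro h
      obtain ⟨b, hb, he⟩ := Finset.mem_image.1 h
      have : b ∈ (ℝ ∙ b)ᗮ := by rw [he]; trivial
      rw [Submodule.mem_orthogonal_singleton_iff_inner_right] at this
      exact h0 b hb (inner_self_eq_zero.1 this))
  rw [Set.ne_univ_iff_exists_notMem] at this
  obtain ⟨x, hx⟩ := this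
  refine ⟨x, fun b hb hbx => hx ?_⟩
  simp only [Set.mem_iUnion]
  exact ⟨(ℝ ∙ b)ᗮ, Finset.mem_image_of_mem _ hb,
    (Submodule.mem_orthogonal_singleton_iff_inner_right).2 hbx⟩

end Part1

section Part2
variable {d : ℕ}

theorem finrank_inf_orth (W : Submodule ℝ (Euc d)) (z w : Euc d) (hw : w ∈ W)
    (hzw : ⟪z, w⟫_ℝ ≠ 0) :
    Module.finrank ℝ W = Module.finrank ℝ ↥(W ⊓ (ℝ ∙ z)ᗮ) + 1 := by
  have hz : z ≠ 0 := by rintro rfl; simp at hzw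
  have h1 := Submodule.finrank_sup_add_finrank_inf_eq W (ℝ ∙ z)ᗮ
  have h3 := (ℝ ∙ z).finrank_add_finrank_orthogonal
  rw [finrank_span_singleton hz] at h3
  have h4 : W ⊔ (ℝ ∙ z)ᗮ = ⊤ := by
    rw [eq_top_iff]
    intro y _
    have : y = (⟪z, y⟫_ℝ / ⟪z, w⟫_ℝ) • w + (y - (⟪z, y⟫_ℝ / ⟪z, w⟫_ℝ) • w) := by abel
    rw [this]
    refine Submodule.add_mem_sup (W.smul_mem _ hw) ?_
    rw [Submodule.mem_orthogonal_singleton_iff_inner_right, inner_sub_right, inner_smul_right]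
    field_simp
    ring
  rw [h4, finrank_top] at h1
  omega

open Classical in
/-- The weight of the piece of `σ` on which `⟪z, ·⟫` has sign `s`. -/
def pieceW (σ : Set (Euc d)) (W : Submodule ℝ (Euc d)) (z x : Euc d) (s : SignType) : ℝ :=
  if (∃ c ∈ σ, SignType.sign ⟪z, c⟫_ℝ = s) ∧ (∀ c ∈ σ, SignType.sign ⟪z, c⟫_ℝ = s → ⟪x, c⟫_ℝ ≤ 0)
  then (-1) ^ Module.finrank ℝ ↥(if s = 0 then W ⊓ (ℝ ∙ z)ᗮ else W) else 0

theorem sum_signType (f : SignType → ℝ) : ∑ s, f s = f 0 + f 1 + f (-1) := by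
  have : (Finset.univ : Finset SignType) = {0, 1, -1} := by decide
  rw [this, Finset.sum_insert (by decide), Finset.sum_insert (by decide), Finset.sum_singleton]
  ring

theorem convex_zero {σ : Set (Euc d)} (hσ : Convex ℝ σ) (z x : Euc d) {a b : Euc d} (ha : a ∈ σ)
    (hb : b ∈ σ) (hza : 0 < ⟪z, a⟫_ℝ) (hzb : ⟪z, b⟫_ℝ < 0) :
    ∃ c ∈ σ, ⟪z, c⟫_ℝ = 0 ∧ (0 < ⟪x, a⟫_ℝ → 0 < ⟪x, b⟫_ℝ → 0 < ⟪x, c⟫_ℝ) := by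
  have hD : 0 < ⟪z, a⟫_ℝ - ⟪z, b⟫_ℝ := by linarith
  have h1 : 0 < -⟪z, b⟫_ℝ / (⟪z, a⟫_ℝ - ⟪z, b⟫_ℝ) := div_pos (by linarith) hD
  have h2 : 0 < ⟪z, a⟫_ℝ / (⟪z, a⟫_ℝ - ⟪z, b⟫_ℝ) := div_pos hza hD
  refine ⟨(-⟪z, b⟫_ℝ / (⟪z, a⟫_ℝ - ⟪z, b⟫_ℝ)) • a + (⟪z, a⟫_ℝ / (⟪z, a⟫_ℝ - ⟪z, b⟫_ℝ)) • b,
    hσ ha hb h1.le h2.le (by field_simp; ring), ?_, ?_⟩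
  · rw [inner_add_right, inner_smul_right, inner_smul_right]
    field_simp
    ring
  · intro hxa hxb
    rw [inner_add_right, inner_smul_right, inner_smul_right]
    exact add_pos (mul_pos h1 hxa) (mul_pos h2 hxb)

theorem closure_le {σ : Set (Euc d)} (hσ : Convex ℝ σ) (z x : Euc d) {a c : Euc d} (ha : a ∈ σ)
    (hc : c ∈ σ) (hza : ⟪z, a⟫_ℝ ≠ 0) (hzc : ⟪z, c⟫_ℝ = 0)
    (h : ∀ y ∈ σ, SignType.sign ⟪z, y⟫_ℝ = SignType.sign ⟪z, a⟫_ℝ → ⟪x, y⟫_ℝ ≤ 0) :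
    ⟪x, c⟫_ℝ ≤ 0 := by
  have key : ∀ t : ℝ, 0 < t → t ≤ 1 → (1 - t) * ⟪x, c⟫_ℝ + t * ⟪x, a⟫_ℝ ≤ 0 := by
    intro t ht ht1
    have := h ((1 - t) • c + t • a) (hσ hc ha (by linarith) ht.le (by ring)) (by
      rw [inner_add_right, inner_smul_right, inner_smul_right, hzc, mul_zero, zero_add,
        sign_mul, sign_pos ht, one_mul])
    rwa [inner_add_right, inner_smul_right, inner_smul_right] at this
  have hcont : Filter.Tendsto (fun t : ℝ => (1 - t) * ⟪x, c⟫_ℝ + t * ⟪x, a⟫_ℝ)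
      (nhdsWithin 0 (Set.Ioi 0)) (nhds ⟪x, c⟫_ℝ) := by
    have : ContinuousAt (fun t : ℝ => (1 - t) * ⟪x, c⟫_ℝ + t * ⟪x, a⟫_ℝ) 0 := by fun_prop
    have h := this.tendsto
    simp only [sub_zero, one_mul, zero_mul, add_zero] at h
    exact h.mono_left nhdsWithin_le_nhds
  refine le_of_tendsto hcont ?_
  filter_upwards [Ioc_mem_nhdsGT (zero_lt_one' ℝ)] with t ht using key t ht.1 ht.2

open Classical in
theorem piece_sum (σ : Set (Euc d)) (W : Submodule ℝ (Euc d)) (z x : Euc d) (hσ : Convex ℝ σ)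
    (hsub : ∀ c ∈ σ, c ∈ W)
    (hop : ∀ c ∈ σ, ∀ w ∈ W, ∃ δ : ℝ, 0 < δ ∧ c + δ • w ∈ σ ∧ c - δ • w ∈ σ) :
    ∑ s, pieceW σ W z x s
      = if (∃ c, c ∈ σ) ∧ (∀ c ∈ σ, ⟪x, c⟫_ℝ ≤ 0) then (-1) ^ Module.finrank ℝ W else 0 := by
  by_cases hne : ∃ c, c ∈ σ
  swap
  · have : ∀ c, c ∉ σ := fun c hc => hne ⟨c, hc⟩
    simp [pieceW, this]
  by_cases h0 : ∃ c ∈ σ, ⟪z, c⟫_ℝ = 0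
  swap
  · obtain ⟨a, ha⟩ := hne
    have hs : ∀ c ∈ σ, SignType.sign ⟪z, c⟫_ℝ = SignType.sign ⟪z, a⟫_ℝ := by
      intro c hc
      have hc0 : ⟪z, c⟫_ℝ ≠ 0 := fun h => h0 ⟨c, hc, h⟩
      have ha0 : ⟪z, a⟫_ℝ ≠ 0 := fun h => h0 ⟨a, ha, h⟩
      rcases lt_or_gt_of_ne hc0 with h1 | h1 <;> rcases lt_or_gt_of_ne ha0 with h2 | h2
      · rw [sign_neg h1, sign_neg h2]
      · obtain ⟨y, hy, hy0, _⟩ := convex_zero hσ z x ha hc h2 h1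
        exact absurd ⟨y, hy, hy0⟩ h0
      · obtain ⟨y, hy, hy0, _⟩ := convex_zero hσ z x hc ha h1 h2
        exact absurd ⟨y, hy, hy0⟩ h0
      · rw [sign_pos h1, sign_pos h2]
    have hsa : SignType.sign ⟪z, a⟫_ℝ ≠ 0 := by
      rw [sign_ne_zero]; exact fun h => h0 ⟨a, ha, h⟩
    rw [Finset.sum_eq_single (SignType.sign ⟪z, a⟫_ℝ)]
    · unfold pieceW
      rw [if_neg hsa]
      congr 1
      refine propext (and_congr ⟨fun _ => ⟨a, ha⟩, fun _ => ⟨a, ha, rfl⟩⟩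
        (forall₂_congr fun c hc => ?_))
      simp [hs c hc]
    · intro s _ hsne
      unfold pieceW
      rw [if_neg]
      rintro ⟨⟨c, hc, hcs⟩, _⟩
      exact hsne (by rw [← hcs, hs c hc])
    · simp
  obtain ⟨c0, hc0, hz0⟩ := h0
  by_cases hW : ∃ w ∈ W, ⟪z, w⟫_ℝ ≠ 0
  swap
  · push Not at hW
    have hs : ∀ c ∈ σ, SignType.sign ⟪z, c⟫_ℝ = 0 := fun c hc => by
      rw [hW c (hsub c hc), sign_zero]
    have hWW : W ⊓ (ℝ ∙ z)ᗮ = W := by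
      refine inf_eq_left.2 fun w hw => ?_
      rw [Submodule.mem_orthogonal_singleton_iff_inner_right]
      exact hW w hw
    rw [Finset.sum_eq_single 0]
    · unfold pieceW
      rw [if_pos rfl, hWW]
      congr 1
      refine propext (and_congr ⟨fun _ => hne, fun _ => ⟨c0, hc0, hs _ hc0⟩⟩
        (forall₂_congr fun c hc => ?_))
      simp [hs c hc]
    · intro s _ hsne
      unfold pieceW
      rw [if_neg]
      rintro ⟨⟨c, hc, hcs⟩, _⟩
      exact hsne (by rw [← hcs, hs c hc])
    · simp
  obtain ⟨w, hw, hzw⟩ := hW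
  have hpm : (∃ c ∈ σ, 0 < ⟪z, c⟫_ℝ) ∧ (∃ c ∈ σ, ⟪z, c⟫_ℝ < 0) := by
    obtain ⟨δ, hδ, h1, h2⟩ := hop c0 hc0 w hw
    have e1 : ⟪z, c0 + δ • w⟫_ℝ = δ * ⟪z, w⟫_ℝ := by
      rw [inner_add_right, inner_smul_right, hz0, zero_add]
    have e2 : ⟪z, c0 - δ • w⟫_ℝ = -(δ * ⟪z, w⟫_ℝ) := by
      rw [inner_sub_right, inner_smul_right, hz0, zero_sub]
    rcases lt_or_gt_of_ne hzw with h | h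
    · have := mul_neg_of_pos_of_neg hδ h
      exact ⟨⟨_, h2, by rw [e2]; linarith⟩, ⟨_, h1, by rw [e1]; linarith⟩⟩
    · have := mul_pos hδ h
      exact ⟨⟨_, h1, by rw [e1]; linarith⟩, ⟨_, h2, by rw [e2]; linarith⟩⟩
  obtain ⟨⟨cp, hcp, hzp⟩, ⟨cm, hcm, hzm⟩⟩ := hpm
  have hfr := finrank_inf_orth W z w hw hzw
  have E0 : (∃ c ∈ σ, SignType.sign ⟪z, c⟫_ℝ = 0) := ⟨c0, hc0, by rw [hz0, sign_zero]⟩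
  have E1 : (∃ c ∈ σ, SignType.sign ⟪z, c⟫_ℝ = 1) := ⟨cp, hcp, sign_pos hzp⟩
  have E2 : (∃ c ∈ σ, SignType.sign ⟪z, c⟫_ℝ = -1) := ⟨cm, hcm, sign_neg hzm⟩
  have n1 : (1 : SignType) ≠ 0 := by decide
  have n2 : (-1 : SignType) ≠ 0 := by decide
  rw [sum_signType]
  unfold pieceW
  rw [if_pos (rfl : (0 : SignType) = 0), if_neg n1, if_neg n2]
  simp only [E0, E1, E2, hne, true_and]
  have hpow : (-1 : ℝ) ^ Module.finrank ℝ ↥(W ⊓ (ℝ ∙ z)ᗮ) = - (-1) ^ Module.finrank ℝ W := by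
    rw [hfr, pow_succ]; ring
  rw [hpow]
  set K0 := ∀ c ∈ σ, SignType.sign ⟪z, c⟫_ℝ = 0 → ⟪x, c⟫_ℝ ≤ 0 with hK0
  set K1 := ∀ c ∈ σ, SignType.sign ⟪z, c⟫_ℝ = 1 → ⟪x, c⟫_ℝ ≤ 0 with hK1
  set K2 := ∀ c ∈ σ, SignType.sign ⟪z, c⟫_ℝ = -1 → ⟪x, c⟫_ℝ ≤ 0 with hK2
  set K := ∀ c ∈ σ, ⟪x, c⟫_ℝ ≤ 0 with hK
  have i1 : K1 → K0 := by
    intro h c hc hz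
    refine closure_le hσ z x hcp hc hzp.ne' (sign_eq_zero_iff.1 hz) fun y hy hys => h y hy ?_
    rw [hys, sign_pos hzp]
  have i2 : K2 → K0 := by
    intro h c hc hz
    refine closure_le hσ z x hcm hc hzm.ne (sign_eq_zero_iff.1 hz) fun y hy hys => h y hy ?_
    rw [hys, sign_neg hzm]
  have i3 : K0 → K1 ∨ K2 := by
    intro h
    by_contra hcon
    rw [not_or, hK1, hK2] at hcon
    push Not at hcon
    obtain ⟨⟨a, ha, hza, hxa⟩, ⟨b, hb, hzb, hxb⟩⟩ := hcon
    obtain ⟨y, hy, hy0, hyx⟩ := convex_zero hσ z x ha hb (sign_eq_one_iff.1 hza)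
      (sign_eq_neg_one_iff.1 hzb)
    have := h y hy (by rw [hy0, sign_zero])
    linarith [hyx hxa hxb]
  have i4 : K ↔ (K0 ∧ K1 ∧ K2) := by
    constructor
    · intro h; exact ⟨fun c hc _ => h c hc, fun c hc _ => h c hc, fun c hc _ => h c hc⟩
    · rintro ⟨h0, h1, h2⟩ c hc
      rcases lt_trichotomy ⟪z, c⟫_ℝ 0 with h | h | h
      · exact h2 c hc (sign_neg h)
      · exact h0 c hc (by rw [h, sign_zero])
      · exact h1 c hc (sign_pos h)
  clear_value K0 K1 K2 K
  by_cases k0 : K0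
  · rcases i3 k0 with k | k
    · by_cases k' : K2 <;> simp [k0, k, k', i4]
    · by_cases k' : K1 <;> simp [k0, k, k', i4]
  · have k1 : ¬ K1 := fun h => k0 (i1 h)
    have k2 : ¬ K2 := fun h => k0 (i2 h)
    simp [k0, k1, k2, i4]

/-- Sign vector. -/
def sg {n : ℕ} (z : Fin n → Euc d) (c : Euc d) : Fin n → SignType :=
  fun i => SignType.sign ⟪z i, c⟫_ℝ

/-- The span of a cell with sign vector `ε`. -/
def wsub (V : Submodule ℝ (Euc d)) {n : ℕ} (z : Fin n → Euc d) (ε : Fin n → SignType) :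
    Submodule ℝ (Euc d) :=
  V ⊓ ⨅ i : {i // ε i = 0}, (ℝ ∙ z i)ᗮ

theorem mem_wsub {V : Submodule ℝ (Euc d)} {n : ℕ} {z : Fin n → Euc d} {ε : Fin n → SignType}
    {c : Euc d} : c ∈ wsub V z ε ↔ c ∈ V ∧ ∀ i, ε i = 0 → ⟪z i, c⟫_ℝ = 0 := by
  unfold wsub
  rw [Submodule.mem_inf, Submodule.mem_iInf]
  simp [Submodule.mem_orthogonal_singleton_iff_inner_right]

theorem sign_eventually {a : ℝ} (b : ℝ) (h : a = 0 → b = 0) :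
    ∀ᶠ t : ℝ in nhds 0, SignType.sign (a + t * b) = SignType.sign a := by
  by_cases ha : a = 0
  · simp [ha, h ha]
  · have hc : ContinuousAt (fun t : ℝ => a + t * b) 0 := by fun_prop
    rcases lt_or_gt_of_ne ha with h1 | h1
    · filter_upwards [hc.tendsto.eventually_lt_const (u := 0) (by simpa using h1)] with t ht
      rw [sign_neg h1, sign_neg ht]
    · filter_upwards [hc.tendsto.eventually_const_lt (u := 0) (by simpa using h1)] with t ht
      rw [sign_pos h1, sign_pos ht]

theorem sg_eventually {n : ℕ} (z : Fin n → Euc d) (c w : Euc d)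
    (h : ∀ i, ⟪z i, c⟫_ℝ = 0 → ⟪z i, w⟫_ℝ = 0) :
    ∀ᶠ t : ℝ in nhds 0, sg z (c + t • w) = sg z c := by
  have : ∀ i, ∀ᶠ t : ℝ in nhds 0, SignType.sign ⟪z i, c + t • w⟫_ℝ = SignType.sign ⟪z i, c⟫_ℝ := by
    intro i
    simp only [inner_add_right, inner_smul_right]
    exact sign_eventually _ (h i)
  filter_upwards [Filter.eventually_all.2 this] with t ht
  funext i
  exact ht i

theorem sign_convex {a b s t : ℝ} (hs : 0 ≤ s) (ht : 0 ≤ t) (hst : s + t = 1)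
    (h : SignType.sign a = SignType.sign b) : SignType.sign (s * a + t * b) = SignType.sign b := by
  rcases lt_trichotomy b 0 with hb | hb | hb
  · rw [sign_neg hb] at h ⊢
    have ha := sign_eq_neg_one_iff.1 h
    rw [sign_eq_neg_one_iff]
    rcases hs.eq_or_lt with h1 | h1
    · have : t = 1 := by linarith
      rw [← h1, this]; linarith
    · nlinarith
  · rw [hb, sign_zero] at h ⊢
    rw [sign_eq_zero_iff.1 h]; simp
  · rw [sign_pos hb] at h ⊢
    have ha := sign_eq_one_iff.1 h
    rw [sign_eq_one_iff]
    rcases hs.eq_or_lt with h1 | h1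
    · have : t = 1 := by linarith
      rw [← h1, this]; linarith
    · nlinarith

open Classical in
/-- Euler relation for the cells of an arrangement inside a halfspace. -/
theorem euler_sum (V : Submodule ℝ (Euc d)) (x : Euc d) : ∀ (n : ℕ) (z : Fin n → Euc d),
    ∑ ε : Fin n → SignType, (if (∃ c ∈ V, sg z c = ε) ∧ (∀ c ∈ V, sg z c = ε → ⟪x, c⟫_ℝ ≤ 0)
      then (-1 : ℝ) ^ Module.finrank ℝ (wsub V z ε) else 0)
    = if ∀ c ∈ V, ⟪x, c⟫_ℝ = 0 then (-1) ^ Module.finrank ℝ V else 0 := by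
  intro n
  induction n with
  | zero =>
    intro z
    have hW : ∀ ε, wsub V z ε = V := by
      intro ε; ext c; rw [mem_wsub]; simp
    have hs : ∀ (c : Euc d) (ε : Fin 0 → SignType), sg z c = ε := fun c ε => Subsingleton.elim _ _
    simp only [Finset.univ_unique, Finset.sum_singleton]
    rw [hW]
    congr 1
    refine propext ⟨fun h c hc => ?_, fun h => ⟨⟨0, V.zero_mem, hs _ _⟩, fun c hc _ => (h c hc).le⟩⟩
    have h1 := h.2 c hc (hs _ _)
    have h2 := h.2 (-c) (V.neg_mem hc) (hs _ _)
    rw [inner_neg_right] at h2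
    linarith
  | succ n ih =>
    intro z
    rw [← ih (fun i => z i.succ), ← (Fin.consEquiv (fun _ => SignType)).sum_comp,
      Fintype.sum_prod_type_right]
    refine Finset.sum_congr rfl fun ε _ => ?_
    set σ : Set (Euc d) := {c | c ∈ V ∧ sg (fun i => z i.succ) c = ε} with hσ
    have hcond : ∀ c s, sg z c = Fin.cons s ε ↔
        (SignType.sign ⟪z 0, c⟫_ℝ = s ∧ sg (fun i => z i.succ) c = ε) := by
      intro c s
      constructor
      · intro h
        refine ⟨by simpa [sg] using congrFun h 0, ?_⟩
        funext i
        simpa [sg] using congrFun h i.succ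
      · rintro ⟨h1, h2⟩
        funext i
        refine Fin.cases ?_ (fun i => ?_) i
        · simpa [sg] using h1
        · simpa [sg] using congrFun h2 i
    have := piece_sum σ (wsub V (fun i => z i.succ) ε) (z 0) x (by
        intro a ha b hb s t hs ht hst
        refine ⟨V.add_mem (V.smul_mem _ ha.1) (V.smul_mem _ hb.1), ?_⟩
        rw [← hb.2]
        funext i
        have e : sg (fun i => z i.succ) a i = sg (fun i => z i.succ) b i := by rw [ha.2, hb.2]
        simp only [sg] at e ⊢
        rw [inner_add_right, inner_smul_right, inner_smul_right]
        exact sign_convex hs ht hst e) (by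
        rintro c ⟨hc, rfl⟩
        rw [mem_wsub]
        exact ⟨hc, fun i hi => sign_eq_zero_iff.1 hi⟩) (by
        rintro c ⟨hc, hce⟩ w hw
        rw [mem_wsub] at hw
        have h1 := sg_eventually (fun i => z i.succ) c w (fun i hi => hw.2 i (by
          rw [← hce]; exact sign_eq_zero_iff.2 hi))
        have h2 := sg_eventually (fun i => z i.succ) c (-w) (fun i hi => by
          rw [inner_neg_right, hw.2 i (by rw [← hce]; exact sign_eq_zero_iff.2 hi), neg_zero])
        have h3 := ((h1.and h2).filter_mono (nhdsWithin_le_nhds (s := Set.Ioi 0))).and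
          self_mem_nhdsWithin
        obtain ⟨t, ⟨ht1, ht2⟩, ht⟩ := h3.exists
        refine ⟨t, ht, ⟨V.add_mem hc (V.smul_mem _ hw.1), ht1.trans hce⟩,
          ⟨V.sub_mem hc (V.smul_mem _ hw.1), ?_⟩⟩
        rw [smul_neg, ← sub_eq_add_neg] at ht2
        exact ht2.trans hce)
    have e2 : (if (∃ c ∈ V, sg (fun i => z i.succ) c = ε) ∧
        (∀ c ∈ V, sg (fun i => z i.succ) c = ε → ⟪x, c⟫_ℝ ≤ 0)
        then (-1 : ℝ) ^ Module.finrank ℝ (wsub V (fun i => z i.succ) ε) else 0)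
        = if (∃ c, c ∈ σ) ∧ (∀ c ∈ σ, ⟪x, c⟫_ℝ ≤ 0) then
          (-1) ^ Module.finrank ℝ (wsub V (fun i => z i.succ) ε) else 0 := by
      congr 1
      simp [hσ]
    rw [e2, ← this]
    refine Finset.sum_congr rfl fun s _ => ?_
    unfold pieceW
    have hw : wsub V z ((Fin.consEquiv fun _ => SignType) (s, ε))
        = if s = 0 then wsub V (fun i => z i.succ) ε ⊓ (ℝ ∙ z 0)ᗮ
          else wsub V (fun i => z i.succ) ε := by
      ext c
      rw [mem_wsub]
      split_ifs with hs
      · rw [Submodule.mem_inf, mem_wsub, Submodule.mem_orthogonal_singleton_iff_inner_right,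
          Fin.forall_fin_succ]
        simp [Fin.consEquiv, hs]
        tauto
      · rw [mem_wsub, Fin.forall_fin_succ]
        simp [Fin.consEquiv, hs]
    rw [hw]
    congr 1
    have e3 : ((Fin.consEquiv fun _ => SignType) (s, ε)) = (Fin.cons s ε : Fin (n+1) → SignType) := rfl
    rw [e3]
    simp only [hcond, hσ, Set.mem_setOf_eq]
    refine propext (and_congr ?_ ?_)
    · constructor
      · rintro ⟨c, h1, h2, h3⟩; exact ⟨c, ⟨h1, h3⟩, h2⟩
      · rintro ⟨c, ⟨h1, h3⟩, h2⟩; exact ⟨c, h1, h2, h3⟩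
    · constructor
      · rintro h c ⟨h1, h3⟩ h2; exact h c h1 ⟨h2, h3⟩
      · rintro h c h1 ⟨h2, h3⟩; exact h c ⟨h1, h3⟩ h2

end Part2

section Part3

theorem chains_finite {β : Type*} [PartialOrder β] [Finite β] (a c : β) :
    (chainsFromTo a c).Finite := by
  classical
  haveI := Fintype.ofFinite β
  have h : Set.Finite {l : List β | l.Nodup} :=
    Set.finite_coe_iff.1 (inferInstanceAs (Finite {l : List β // l.Nodup}))
  refine h.subset ?_
  rintro l ⟨h1, _, _⟩
  have : l.IsChain (· < ·) := h1
  exact (List.isChain_iff_pairwise.1 this).imp (fun h => h.ne)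

theorem chain_self {β : Type*} [PartialOrder β] (a : β) : chainsFromTo a a = {[a]} := by
  ext l
  simp only [Set.mem_singleton_iff]
  constructor
  · rintro ⟨h1, h2, h3⟩
    have h1 : l.IsChain (· < ·) := h1
    cases l with
    | nil => simp at h2
    | cons b l =>
      simp at h2
      subst h2
      cases l with
      | nil => rfl
      | cons b' l =>
        exfalso
        rw [List.getLast?_cons_cons] at h3
        have hm := List.mem_of_getLast? h3
        have := List.rel_of_pairwise_cons (List.isChain_iff_pairwise.1 h1) hm
        exact lt_irrefl _ this
  · rintro rfl
    exact ⟨List.isChain_singleton _, by simp, by simp⟩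

theorem mob_self {β : Type*} [PartialOrder β] (a : β) : mob a a = 1 := by
  unfold mob
  rw [chain_self, finsum_mem_singleton]
  norm_num

theorem chain_cons {β : Type*} [PartialOrder β] {a c : β} (hac : a ≠ c) (l : List β) :
    l ∈ chainsFromTo a c ↔ ∃ b, a < b ∧ ∃ l' ∈ chainsFromTo b c, l = a :: l' := by
  constructor
  · rintro ⟨h1, h2, h3⟩
    have h1 : l.IsChain (· < ·) := h1
    cases l with
    | nil => simp at h2
    | cons b l =>
      simp at h2
      subst h2
      cases l with
      | nil => simp at h3; exact absurd h3 hac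
      | cons b' l =>
        rw [List.getLast?_cons_cons] at h3
        rw [List.isChain_cons_cons] at h1
        exact ⟨b', h1.1, b' :: l, ⟨h1.2, by simp, h3⟩, rfl⟩
  · rintro ⟨b, hab, l', ⟨h1, h2, h3⟩, rfl⟩
    have h1 : l'.IsChain (· < ·) := h1
    cases l' with
    | nil => simp at h2
    | cons b' l =>
      simp at h2
      subst h2
      refine ⟨?_, by simp, by rw [List.getLast?_cons_cons]; exact h3⟩
      exact List.isChain_cons_cons.2 ⟨hab, h1⟩

theorem mob_eq_zero {β : Type*} [PartialOrder β] {a c : β} (hac : ¬ a ≤ c) : mob a c = 0 := by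
  unfold mob
  have : chainsFromTo a c = ∅ := by
    rw [Set.eq_empty_iff_forall_notMem]
    rintro l ⟨h1, h2, h3⟩
    have h1 : l.IsChain (· < ·) := h1
    cases l with
    | nil => simp at h2
    | cons b l =>
      simp at h2
      subst h2
      cases l with
      | nil => simp at h3; exact hac h3.le
      | cons b' l =>
        rw [List.getLast?_cons_cons] at h3
        have hm := List.mem_of_getLast? h3
        exact hac (List.rel_of_pairwise_cons (List.isChain_iff_pairwise.1 h1) hm).le
  rw [this, finsum_mem_empty]

open Classical in
theorem mob_rec {β : Type*} [PartialOrder β] [Fintype β] {a c : β} (hac : a ≠ c) :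
    mob a c = - ∑ b ∈ Finset.univ.filter (fun b => a < b), mob b c := by
  have e : ∀ x : β, mob x c = ∑ l ∈ (chains_finite x c).toFinset, (-1 : ℝ) ^ (l.length + 1) := by
    intro x
    unfold mob
    rw [finsum_mem_eq_finite_toFinset_sum]
  have h : (chains_finite a c).toFinset = (Finset.univ.filter (fun b => a < b)).biUnion
      (fun b => (chains_finite b c).toFinset.image (List.cons a)) := by
    ext l
    rw [Set.Finite.mem_toFinset, chain_cons hac]
    simp only [Finset.mem_biUnion, Finset.mem_filter, Finset.mem_univ, true_and, Finset.mem_image,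
      Set.Finite.mem_toFinset]
    constructor
    · rintro ⟨b, hb, l', hl', rfl⟩; exact ⟨b, hb, l', hl', rfl⟩
    · rintro ⟨b, hb, l', hl', rfl⟩; exact ⟨b, hb, l', hl', rfl⟩
  rw [e, h, Finset.sum_biUnion, ← Finset.sum_neg_distrib]
  · refine Finset.sum_congr rfl fun b _ => ?_
    rw [Finset.sum_image (fun x _ y _ hxy => (List.cons.inj hxy).2), e, ← Finset.sum_neg_distrib]
    refine Finset.sum_congr rfl fun l _ => ?_
    rw [List.length_cons, pow_succ]
    ring
  · intro b _ b' _ hbb'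
    rw [Function.onFun, Finset.disjoint_left]
    intro l hl hl'
    simp only [Finset.mem_image, Set.Finite.mem_toFinset] at hl hl'
    obtain ⟨l1, h1, rfl⟩ := hl
    obtain ⟨l2, h2, h3⟩ := hl'
    rw [(List.cons.inj h3).2] at h2
    have := h1.2.1.symm.trans h2.2.1
    exact hbb' (Option.some.inj this)

open Classical in
theorem mob_unique {β : Type*} [PartialOrder β] [Fintype β] (c : β) (g : β → ℝ)
    (hg : ∀ a ≤ c, ∑ b ∈ Finset.univ.filter (fun b => a ≤ b ∧ b ≤ c), g b = if a = c then 1 else 0) :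
    ∀ a ≤ c, g a = mob a c := by
  intro a
  induction a using (wellFounded_gt (α := β)).induction with
  | _ a ih =>
  intro hac
  have h1 := hg a hac
  have h2 : Finset.univ.filter (fun b => a ≤ b ∧ b ≤ c)
      = insert a (Finset.univ.filter (fun b => a < b ∧ b ≤ c)) := by
    ext b
    simp only [Finset.mem_filter, Finset.mem_univ, true_and, Finset.mem_insert]
    constructor
    · rintro ⟨h, h'⟩
      rcases h.eq_or_lt with h | h
      · exact Or.inl h.symm
      · exact Or.inr ⟨h, h'⟩
    · rintro (rfl | ⟨h, h'⟩)
      · exact ⟨le_rfl, hac⟩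
      · exact ⟨h.le, h'⟩
  rw [h2, Finset.sum_insert (by simp)] at h1
  have h3 : ∑ b ∈ Finset.univ.filter (fun b => a < b ∧ b ≤ c), g b
      = ∑ b ∈ Finset.univ.filter (fun b => a < b), mob b c := by
    rw [← Finset.filter_filter, Finset.sum_filter]
    refine Finset.sum_congr rfl fun b hb => ?_
    split_ifs with hbc
    · exact ih b (by simpa using hb) hbc
    · rw [mob_eq_zero hbc]
  rw [h3] at h1
  split_ifs at h1 with hc
  · subst hc
    rw [mob_self]
    have : ∑ b ∈ Finset.univ.filter (fun b => a < b), mob b a = 0 :=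
      Finset.sum_eq_zero fun b hb => mob_eq_zero (not_le_of_gt (by simpa using hb))
    linarith
  · rw [mob_rec hc]; linarith

theorem mob_dual {β : Type*} [PartialOrder β] (a c : β) :
    mob (OrderDual.toDual c) (OrderDual.toDual a) = mob a c := by
  unfold mob
  symm
  refine finsum_mem_eq_of_bijOn (fun l : List β => (l.map OrderDual.toDual).reverse)
    ⟨?_, ?_, ?_⟩ ?_
  · rintro l ⟨h1, h2, h3⟩
    have h1 : l.IsChain (· < ·) := h1
    refine ⟨?_, ?_, ?_⟩
    · show List.IsChain _ _
      rw [List.isChain_reverse, List.isChain_map]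
      exact h1
    · rw [List.head?_reverse, List.getLast?_map, h3]; rfl
    · rw [List.getLast?_reverse, List.head?_map, h2]; rfl
  · intro l _ l' _ h
    exact List.map_injective_iff.2 OrderDual.toDual.injective (List.reverse_injective h)
  · rintro l ⟨h1, h2, h3⟩
    have h1 : l.IsChain (· < ·) := h1
    refine ⟨(l.map OrderDual.ofDual).reverse, ⟨?_, ?_, ?_⟩, ?_⟩
    · show List.IsChain _ _
      rw [List.isChain_reverse, List.isChain_map]
      exact h1
    · rw [List.head?_reverse, List.getLast?_map, h3]; rfl
    · rw [List.getLast?_reverse, List.head?_map, h2]; rfl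
    · simp
  · intro l _
    simp

end Part3

section Part4
variable {d : ℕ}

theorem maxFace_subset (P : Set (Euc d)) (c : Euc d) : maxFace P c ⊆ P := fun x hx => hx.1

theorem inner_le_of_hull {s : Set (Euc d)} {c : Euc d} {r : ℝ} (h : ∀ v ∈ s, ⟪c, v⟫_ℝ ≤ r) :
    ∀ y ∈ convexHull ℝ s, ⟪c, y⟫_ℝ ≤ r := by
  have hc : Convex ℝ {y : Euc d | ⟪c, y⟫_ℝ ≤ r} := by
    have := convex_halfSpace_le (𝕜 := ℝ) (f := fun y : Euc d => ⟪c, y⟫_ℝ)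
      ⟨fun a b => inner_add_right c a b, fun a b => inner_smul_right c b a⟩ r
    exact this
  intro y hy
  exact convexHull_min (fun v hv => h v hv) hc hy

theorem maxFace_convex {P : Set (Euc d)} (hP : Convex ℝ P) (c : Euc d) : Convex ℝ (maxFace P c) := by
  intro x hx y hy a b ha hb hab
  refine ⟨hP hx.1 hy.1 ha hb hab, fun u hu => ?_⟩
  rw [inner_add_right, inner_smul_right, inner_smul_right]
  have h1 := hx.2 u hu
  have h2 := hy.2 u hu
  have : ⟪c, u⟫_ℝ = a * ⟪c, u⟫_ℝ + b * ⟪c, u⟫_ℝ := by rw [← add_mul, hab, one_mul]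
  rw [this]
  gcongr

theorem maxFace_hull (s : Finset (Euc d)) (c : Euc d) :
    maxFace (convexHull ℝ (s : Set (Euc d))) c
      = convexHull ℝ {v : Euc d | v ∈ s ∧ ∀ u ∈ s, ⟪c, u⟫_ℝ ≤ ⟪c, v⟫_ℝ} := by
  classical
  apply Set.Subset.antisymm
  · intro x hx
    obtain ⟨w, hw0, hw1, hwx⟩ := Finset.mem_convexHull'.1 hx.1
    have hm : ∀ u ∈ s, ⟪c, u⟫_ℝ ≤ ⟪c, x⟫_ℝ := fun u hu => hx.2 u (subset_convexHull ℝ _ hu)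
    have hsum : ∑ v ∈ s, w v * (⟪c, x⟫_ℝ - ⟪c, v⟫_ℝ) = 0 := by
      simp only [mul_sub, Finset.sum_sub_distrib, ← Finset.sum_mul, hw1, one_mul]
      nth_rewrite 1 [← hwx]
      rw [inner_sum]
      simp [inner_smul_right]
    have hz := (Finset.sum_eq_zero_iff_of_nonneg
      (fun v hv => mul_nonneg (hw0 v hv) (sub_nonneg.2 (hm v hv)))).1 hsum
    set s0 := s.filter (fun v => ∀ u ∈ s, ⟪c, u⟫_ℝ ≤ ⟪c, v⟫_ℝ) with hs0
    have he : {v : Euc d | v ∈ s ∧ ∀ u ∈ s, ⟪c, u⟫_ℝ ≤ ⟪c, v⟫_ℝ} = (s0 : Set (Euc d)) := by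
      ext v; simp [hs0]
    have hout : ∀ v ∈ s, v ∉ s0 → w v = 0 := by
      intro v hv hv0
      rcases mul_eq_zero.1 (hz v hv) with h | h
      · exact h
      · exfalso; apply hv0
        rw [hs0, Finset.mem_filter]
        refine ⟨hv, fun u hu => ?_⟩
        rw [← sub_eq_zero.1 h]; exact hm u hu
    rw [he, Finset.mem_convexHull']
    refine ⟨w, fun y hy => hw0 y (Finset.mem_filter.1 hy).1, ?_, ?_⟩
    · rw [← hw1]
      exact Finset.sum_subset (Finset.filter_subset _ _) hout
    · rw [← hwx]
      exact Finset.sum_subset (Finset.filter_subset _ _)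
        (fun v hv hv0 => by rw [hout v hv hv0, zero_smul])
  · refine convexHull_min ?_ (maxFace_convex (convex_convexHull ℝ _) c)
    rintro v ⟨hv, hvm⟩
    exact ⟨subset_convexHull ℝ _ hv, inner_le_of_hull hvm⟩

theorem poly_maxFace_nonempty {P : Set (Euc d)} (hP : IsPolytope P) (c : Euc d) :
    (maxFace P c).Nonempty := by
  obtain ⟨s, hs, rfl⟩ := hP
  obtain ⟨v, hv, hm⟩ := Finset.exists_max_image s (fun v => ⟪c, v⟫_ℝ) hs
  exact ⟨v, subset_convexHull ℝ _ hv, inner_le_of_hull hm⟩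

theorem poly_maxFace {P : Set (Euc d)} (hP : IsPolytope P) (c : Euc d) :
    IsPolytope (maxFace P c) := by
  classical
  have hne := poly_maxFace_nonempty hP c
  obtain ⟨s, hs, rfl⟩ := hP
  refine ⟨s.filter (fun v => ∀ u ∈ s, ⟪c, u⟫_ℝ ≤ ⟪c, v⟫_ℝ), ?_, ?_⟩
  · rw [maxFace_hull] at hne
    rw [convexHull_nonempty_iff] at hne
    obtain ⟨v, hv⟩ := hne
    exact ⟨v, by simpa using hv⟩
  · rw [maxFace_hull]; congr 1; ext v; simp

theorem poly_convex {P : Set (Euc d)} (hP : IsPolytope P) : Convex ℝ P := by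
  obtain ⟨s, hs, rfl⟩ := hP; exact convex_convexHull ℝ _

theorem faces_finite {P : Set (Euc d)} (hP : IsPolytope P) :
    {F | ∃ c, F = maxFace P c}.Finite := by
  classical
  obtain ⟨s, hs, rfl⟩ := hP
  refine ((s.powerset.finite_toSet).image (fun t : Finset (Euc d) => convexHull ℝ (t : Set (Euc d)))).subset ?_
  rintro F ⟨c, rfl⟩
  refine ⟨s.filter (fun v => ∀ u ∈ s, ⟪c, u⟫_ℝ ≤ ⟪c, v⟫_ℝ), by
    rw [Finset.mem_coe, Finset.mem_powerset]; exact Finset.filter_subset _ _, ?_⟩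
  rw [maxFace_hull]; congr 1; ext v; simp

theorem face_iff {P F : Set (Euc d)} (hP : IsPolytope P) :
    (IsFace P F ∧ F.Nonempty) ↔ ∃ c, F = maxFace P c := by
  constructor
  · rintro ⟨h, hne⟩
    obtain ⟨l, hl⟩ := h hne
    refine ⟨(InnerProductSpace.toDual ℝ (Euc d)).symm l, ?_⟩
    rw [hl]
    ext x
    simp [maxFace, InnerProductSpace.toDual_symm_apply]
  · rintro ⟨c, rfl⟩
    refine ⟨fun _ => ⟨InnerProductSpace.toDual ℝ (Euc d) c, ?_⟩, poly_maxFace_nonempty hP c⟩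
    ext x
    simp [maxFace]

theorem lex_eventually (a b : ℝ) :
    ∀ᶠ t : ℝ in nhdsWithin 0 (Set.Ioi 0), (0 ≤ a + t * b ↔ (0 < a ∨ (a = 0 ∧ 0 ≤ b))) := by
  rcases lt_trichotomy a 0 with h | h | h
  · have : Filter.Tendsto (fun t : ℝ => a + t * b) (nhdsWithin 0 (Set.Ioi 0)) (nhds (a + 0 * b)) :=
      (Continuous.tendsto (by fun_prop) 0).mono_left nhdsWithin_le_nhds
    have := this.eventually (gt_mem_nhds (show a + 0 * b < 0 by simpa using h))
    filter_upwards [this] with t ht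
    constructor
    · intro h'; linarith
    · rintro (h' | ⟨h', _⟩) <;> linarith
  · subst h
    filter_upwards [self_mem_nhdsWithin] with t ht
    have ht : 0 < t := ht
    simp [mul_nonneg_iff_of_pos_left ht]
  · have : Filter.Tendsto (fun t : ℝ => a + t * b) (nhdsWithin 0 (Set.Ioi 0)) (nhds (a + 0 * b)) :=
      (Continuous.tendsto (by fun_prop) 0).mono_left nhdsWithin_le_nhds
    have := this.eventually (lt_mem_nhds (show 0 < a + 0 * b by simpa using h))
    filter_upwards [this] with t ht
    simp [h, ht.le]

theorem maxFace_perturb {P : Set (Euc d)} (hP : IsPolytope P) (c w : Euc d) :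
    ∀ᶠ t : ℝ in nhdsWithin 0 (Set.Ioi 0), maxFace P (c + t • w) = maxFace (maxFace P c) w := by
  classical
  obtain ⟨s, hs, rfl⟩ := hP
  have h1 : ∀ v ∈ s, ∀ u ∈ s, ∀ᶠ t : ℝ in nhdsWithin 0 (Set.Ioi 0),
      (⟪c + t • w, u⟫_ℝ ≤ ⟪c + t • w, v⟫_ℝ ↔
        (⟪c, u⟫_ℝ < ⟪c, v⟫_ℝ ∨ (⟪c, u⟫_ℝ = ⟪c, v⟫_ℝ ∧ ⟪w, u⟫_ℝ ≤ ⟪w, v⟫_ℝ))) := by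
    intro v _ u _
    filter_upwards [lex_eventually (⟪c, v⟫_ℝ - ⟪c, u⟫_ℝ) (⟪w, v⟫_ℝ - ⟪w, u⟫_ℝ)] with t ht
    simp only [inner_add_left, inner_smul_left, RCLike.conj_to_real]
    rw [sub_pos, sub_nonneg, sub_eq_zero, eq_comm] at ht
    rw [← ht]
    constructor <;> intro h <;> linarith
  have h2 : ∀ᶠ t : ℝ in nhdsWithin 0 (Set.Ioi 0), ∀ v ∈ s, ∀ u ∈ s,
      (⟪c + t • w, u⟫_ℝ ≤ ⟪c + t • w, v⟫_ℝ ↔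
        (⟪c, u⟫_ℝ < ⟪c, v⟫_ℝ ∨ (⟪c, u⟫_ℝ = ⟪c, v⟫_ℝ ∧ ⟪w, u⟫_ℝ ≤ ⟪w, v⟫_ℝ))) := by
    rw [Finset.eventually_all]
    intro v hv
    rw [Finset.eventually_all]
    exact h1 v hv
  filter_upwards [h2] with t ht
  have he : maxFace (convexHull ℝ (s : Set (Euc d))) c
      = convexHull ℝ ((s.filter (fun v => ∀ u ∈ s, ⟪c, u⟫_ℝ ≤ ⟪c, v⟫_ℝ) : Finset (Euc d)) : Set (Euc d)) := by
    rw [maxFace_hull]; congr 1; ext v; simp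
  rw [he, maxFace_hull, maxFace_hull]
  congr 1
  ext v
  simp only [Set.mem_setOf_eq, Finset.mem_filter]
  constructor
  · rintro ⟨hv, h⟩
    refine ⟨⟨hv, fun u hu => ?_⟩, fun u hu => ?_⟩
    · rcases (ht v hv u hu).1 (h u hu) with h' | ⟨h', _⟩ <;> linarith
    · rcases (ht v hv u hu.1).1 (h u hu.1) with h' | ⟨_, h'⟩
      · have := hu.2 v hv; linarith
      · exact h'
  · rintro ⟨⟨hv, h⟩, h'⟩
    refine ⟨hv, fun u hu => (ht v hv u hu).2 ?_⟩
    rcases (h u hu).lt_or_eq with h3 | h3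
    · exact Or.inl h3
    · exact Or.inr ⟨h3, h' u ⟨hu, fun y hy => h3 ▸ h y hy⟩⟩

theorem maxFace_eq_self {F : Set (Euc d)} {c : Euc d} (h : c ∈ (vectorSpan ℝ F)ᗮ) :
    maxFace F c = F := by
  refine Set.Subset.antisymm (maxFace_subset _ _) fun x hx => ⟨hx, fun y hy => ?_⟩
  have h1 := (Submodule.mem_orthogonal' _ _).1 h (y - x) (vsub_mem_vectorSpan ℝ hy hx)
  rw [inner_sub_right] at h1
  linarith

theorem mem_orth_of_maxFace {F : Set (Euc d)} {c : Euc d} (h : F ⊆ maxFace F c) :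
    c ∈ (vectorSpan ℝ F)ᗮ := by
  have : vectorSpan ℝ F ≤ (ℝ ∙ c)ᗮ := by
    rw [vectorSpan_def, Submodule.span_le]
    rintro _ ⟨x, hx, y, hy, rfl⟩
    simp only [SetLike.mem_coe, Submodule.mem_orthogonal_singleton_iff_inner_right]
    have h1 := (h hx).2 y hy
    have h2 := (h hy).2 x hx
    rw [vsub_eq_sub, inner_sub_right]; linarith
  rw [Submodule.mem_orthogonal']
  intro u hu
  exact (Submodule.mem_orthogonal_singleton_iff_inner_right).1 (this hu)

theorem maxFace_orth (P : Set (Euc d)) (c : Euc d) : c ∈ (vectorSpan ℝ (maxFace P c))ᗮ :=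
  mem_orth_of_maxFace fun x hx => ⟨hx, fun y hy => hx.2 y hy.1⟩

theorem maxFace_sub_orth {P F : Set (Euc d)} {c : Euc d} (hF : F ⊆ maxFace P c) :
    c ∈ (vectorSpan ℝ F)ᗮ :=
  mem_orth_of_maxFace fun x hx => ⟨hx, fun y hy => (hF hx).2 y (hF hy).1⟩

theorem maxFace_congr {G : Set (Euc d)} {c c' : Euc d} (h : c - c' ∈ (vectorSpan ℝ G)ᗮ) :
    maxFace G c = maxFace G c' := by
  have key : ∀ x ∈ G, ∀ y ∈ G, ⟪c, y⟫_ℝ - ⟪c, x⟫_ℝ = ⟪c', y⟫_ℝ - ⟪c', x⟫_ℝ := by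
    intro x hx y hy
    have h1 := (Submodule.mem_orthogonal' _ _).1 h (y - x) (vsub_mem_vectorSpan ℝ hy hx)
    simp only [inner_sub_left, inner_sub_right] at h1
    linarith
  ext x
  constructor <;> rintro ⟨hx, h⟩ <;> refine ⟨hx, fun y hy => ?_⟩ <;>
    have := key x hx y hy <;> have := h y hy <;> linarith

theorem maxFace_of_between {P F : Set (Euc d)} {c c0 : Euc d} (hne : (maxFace P c0).Nonempty)
    (h : maxFace P c0 ⊆ maxFace P c) : maxFace (maxFace P c) c0 = maxFace P c0 := by
  obtain ⟨q, hq⟩ := hne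
  ext x
  constructor
  · rintro ⟨hx, hm⟩
    exact ⟨hx.1, fun y hy => (hq.2 y hy).trans (hm q (h hq))⟩
  · intro hx
    exact ⟨h hx, fun y hy => hx.2 y hy.1⟩

/-- Sums of polyhedral cones are polyhedral. -/
theorem poly_add {C D : Set (Euc d)} (hC : IsPolyhedralCone C) (hD : IsPolyhedralCone D) :
    IsPolyhedralCone (C + D) := by
  obtain ⟨n, v, rfl⟩ := hC
  obtain ⟨m, u, rfl⟩ := hD
  have : {x | ∃ c : Fin n → ℝ, (∀ i, 0 ≤ c i) ∧ x = ∑ i, c i • v i}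
      + {x | ∃ c : Fin m → ℝ, (∀ i, 0 ≤ c i) ∧ x = ∑ i, c i • u i} = vCone (Sum.elim v u) := by
    ext x
    constructor
    · rintro ⟨_, ⟨c, hc, rfl⟩, _, ⟨e, he, rfl⟩, rfl⟩
      refine ⟨Sum.elim c e, ?_, ?_⟩
      · rintro (i | i); exacts [hc i, he i]
      · simp [Fintype.sum_sum_type]
    · rintro ⟨c, hc, rfl⟩
      refine ⟨_, ⟨fun i => c (Sum.inl i), fun i => hc _, rfl⟩, _, ⟨fun i => c (Sum.inr i), fun i => hc _, rfl⟩, ?_⟩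
      simp [Fintype.sum_sum_type]
  rw [this]
  exact vCone_poly _

theorem poly_submodule (W : Submodule ℝ (Euc d)) : IsPolyhedralCone (W : Set (Euc d)) := by
  classical
  obtain ⟨S, hS⟩ := (IsNoetherian.noetherian Wᗮ : Wᗮ.FG)
  have : (W : Set (Euc d)) = hCone (S ∪ S.image (fun x => -x)) := by
    ext x
    constructor
    · intro hx t ht
      have hx : x ∈ W := hx
      have hS' : ∀ t ∈ S, ⟪t, x⟫_ℝ = 0 := fun t ht =>
        (Submodule.mem_orthogonal' _ _).1 (hS ▸ Submodule.subset_span ht : t ∈ Wᗮ) x hx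
      rcases Finset.mem_union.1 ht with ht | ht
      · rw [hS' t ht]
      · obtain ⟨u, hu, rfl⟩ := Finset.mem_image.1 ht
        rw [inner_neg_left, hS' u hu, neg_zero]
    · intro hx
      have h1 : ∀ t ∈ S, ⟪t, x⟫_ℝ = 0 := by
        intro t ht
        have a := hx t (Finset.mem_union_left _ ht)
        have b := hx (-t) (Finset.mem_union_right _ (Finset.mem_image_of_mem _ ht))
        rw [inner_neg_left] at b
        linarith
      have h2 : x ∈ (Wᗮ)ᗮ := by
        rw [← hS, Submodule.mem_orthogonal]
        intro u hu
        induction hu using Submodule.span_induction with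
        | mem u hu => exact h1 u hu
        | zero => simp
        | add a b _ _ ha hb => rw [inner_add_left, ha, hb, add_zero]
        | smul r a _ ha => rw [inner_smul_left, ha, mul_zero]
      rwa [Submodule.orthogonal_orthogonal] at h2
  rw [this]
  exact hCone_poly _

theorem poly_posHull {G : Set (Euc d)} (hG : IsPolytope G) (q : Euc d) :
    IsPolyhedralCone (posHull ((fun x => x - q) '' G)) := by
  classical
  obtain ⟨s, ⟨v0, hv0⟩, rfl⟩ := hG
  have : posHull ((fun x => x - q) '' (convexHull ℝ (s : Set (Euc d))))
      = vCone (fun i : Fin s.card => ((s.equivFin.symm i : Euc d) - q)) := by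
    have key : ∀ f : Euc d → Euc d, ∑ i : Fin s.card, f (s.equivFin.symm i) = ∑ v ∈ s, f v := by
      intro f
      rw [Equiv.sum_comp s.equivFin.symm (fun v : s => f v)]
      exact Finset.sum_coe_sort s f
    ext x
    constructor
    · rintro ⟨c, _, ⟨p, hp, rfl⟩, hc, rfl⟩
      obtain ⟨w, hw0, hw1, hwx⟩ := Finset.mem_convexHull'.1 hp
      refine ⟨fun i => c * w (s.equivFin.symm i), fun i => mul_nonneg hc (hw0 _ (Subtype.mem _)), ?_⟩
      rw [key (fun v => (c * w v) • (v - q))]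
      simp only [mul_smul, ← Finset.smul_sum, smul_sub, Finset.sum_sub_distrib, hwx]
      rw [← Finset.sum_smul, hw1, one_smul]
    · rintro ⟨a, ha, rfl⟩
      have ha' : ∀ v : s, a (s.equivFin v) = (fun u : Euc d => if h : u ∈ s then a (s.equivFin ⟨u, h⟩) else 0) v := by
        intro v; simp
      set b : Euc d → ℝ := fun u : Euc d => if h : u ∈ s then a (s.equivFin ⟨u, h⟩) else 0 with hb
      have hb0 : ∀ u ∈ s, 0 ≤ b u := by
        intro u hu; simp only [hb, hu, dif_pos]; exact ha _
      have hsum : ∑ i, a i • ((s.equivFin.symm i : Euc d) - q) = ∑ v ∈ s, b v • (v - q) := by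
        rw [← key (fun v => b v • (v - q))]
        refine Finset.sum_congr rfl fun i _ => ?_
        rw [← ha' (s.equivFin.symm i), Equiv.apply_symm_apply]
      rw [hsum]
      by_cases hA : ∑ v ∈ s, b v = 0
      · have hz := (Finset.sum_eq_zero_iff_of_nonneg hb0).1 hA
        refine ⟨0, v0 - q, ⟨v0, subset_convexHull ℝ _ hv0, rfl⟩, le_rfl, ?_⟩
        rw [zero_smul]
        exact Finset.sum_eq_zero fun v hv => by rw [hz v hv, zero_smul]
      · have hApos : 0 ≤ ∑ v ∈ s, b v := Finset.sum_nonneg hb0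
        refine ⟨∑ v ∈ s, b v, _, ⟨∑ v ∈ s, (b v / ∑ v ∈ s, b v) • v, ?_, rfl⟩, hApos, ?_⟩
        · rw [Finset.mem_convexHull']
          refine ⟨fun v => b v / ∑ v ∈ s, b v, fun v hv => div_nonneg (hb0 v hv) hApos, ?_, rfl⟩
          rw [← Finset.sum_div, div_self hA]
        · rw [smul_sub, Finset.smul_sum]
          simp only [smul_smul, mul_div_cancel₀ _ hA, smul_sub, Finset.sum_sub_distrib, ← Finset.sum_smul]
  rw [this]
  exact vCone_poly _

theorem innerCone_poly {F G : Set (Euc d)} (hG : IsPolytope G) : IsPolyhedralCone (innerCone F G) :=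
  poly_add (poly_posHull hG _) (poly_submodule _)

theorem normalCone_poly {F G : Set (Euc d)} (hF : IsPolytope F) (hG : IsPolytope G) :
    IsPolyhedralCone (normalCone F G) := by
  classical
  obtain ⟨s, hs, rfl⟩ := hF
  obtain ⟨r, hr, rfl⟩ := hG
  have : normalCone (convexHull ℝ (s : Set (Euc d))) (convexHull ℝ (r : Set (Euc d)))
      = hCone ((s ×ˢ r).image fun p => p.1 - p.2) := by
    ext c
    constructor
    · intro h t ht
      obtain ⟨⟨x, y⟩, hp, rfl⟩ := Finset.mem_image.1 ht
      rw [Finset.mem_product] at hp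
      have := h x (subset_convexHull ℝ _ hp.1) y (subset_convexHull ℝ _ hp.2)
      rw [inner_sub_left, real_inner_comm, real_inner_comm c y]
      simp only; linarith
    · intro h x hx y hy
      have h1 : ∀ u ∈ s, ∀ v ∈ r, ⟪c, v⟫_ℝ ≤ ⟪c, u⟫_ℝ := by
        intro u hu v hv
        have := h (u - v) (Finset.mem_image.2 ⟨(u, v), Finset.mem_product.2 ⟨hu, hv⟩, rfl⟩)
        rw [inner_sub_left, real_inner_comm, real_inner_comm c v] at this
        linarith
      have h2 : ∀ u ∈ s, ⟪c, y⟫_ℝ ≤ ⟪c, u⟫_ℝ := fun u hu => inner_le_of_hull (h1 u hu) y hy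
      have h3 := inner_le_of_hull (s := (s : Set (Euc d))) (c := -c) (r := -⟪c, y⟫_ℝ)
        (fun u hu => by rw [inner_neg_left]; linarith [h2 u hu]) x hx
      rw [inner_neg_left] at h3; linarith
  rw [this]
  exact hCone_poly _

theorem outerCone_poly {F G : Set (Euc d)} (hF : IsPolytope F) (hG : IsPolytope G) :
    IsPolyhedralCone (outerCone F G) :=
  poly_add (normalCone_poly hF hG) (poly_submodule _)

theorem relPt_mem {F : Set (Euc d)} (hF : IsPolytope F) : relPt F ∈ intrinsicInterior ℝ F := by
  have hne : F.Nonempty := by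
    obtain ⟨s, hs, rfl⟩ := hF
    exact convexHull_nonempty_iff.2 hs.to_set
  have : (intrinsicInterior ℝ F).Nonempty := hne.intrinsicInterior (poly_convex hF)
  unfold relPt
  rw [dif_pos this]
  exact this.some_mem

theorem relint_const {F : Set (Euc d)} {q c : Euc d} (hq : q ∈ intrinsicInterior ℝ F)
    (h : ∀ y ∈ F, ⟪c, y⟫_ℝ ≤ ⟪c, q⟫_ℝ) : ∀ y ∈ F, ⟪c, y⟫_ℝ = ⟪c, q⟫_ℝ := by
  intro y hy
  refine le_antisymm (h y hy) ?_
  obtain ⟨q', hq', rfl⟩ := (mem_intrinsicInterior).1 hq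
  have hya : y ∈ affineSpan ℝ F := subset_affineSpan ℝ F hy
  let f : ℝ → affineSpan ℝ F := fun t =>
    ⟨AffineMap.lineMap (q' : Euc d) y (-t), AffineMap.lineMap_mem _ q'.2 hya⟩
  have hf : Continuous f := by
    refine Continuous.subtype_mk ?_ _
    simp only [AffineMap.lineMap_apply]
    fun_prop
  have hf0 : f 0 = q' := by
    apply Subtype.ext; simp [f]
  have hev : ∀ᶠ t in nhds (0:ℝ), f t ∈ interior ((↑) ⁻¹' F : Set (affineSpan ℝ F)) :=
    hf.continuousAt.eventually_mem (by rw [hf0]; exact isOpen_interior.mem_nhds hq')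
  have hev2 : ∀ᶠ t in nhdsWithin (0:ℝ) (Set.Ioi 0), f t ∈ interior ((↑) ⁻¹' F : Set (affineSpan ℝ F)) :=
    hev.filter_mono nhdsWithin_le_nhds
  obtain ⟨t, ht, ht0⟩ := (hev2.and self_mem_nhdsWithin).exists
  have ht0 : 0 < t := ht0
  have hmem : ((f t : affineSpan ℝ F) : Euc d) ∈ F := (interior_subset ht : f t ∈ ((↑) ⁻¹' F : Set (affineSpan ℝ F)))
  have := h _ hmem
  simp only [f, AffineMap.lineMap_apply, vsub_eq_sub, vadd_eq_add, inner_add_right, inner_smul_right, inner_sub_right] at this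
  nlinarith

/-- Dual description of the tangent cone. -/
theorem mem_innerCone {G : Set (Euc d)} (hG : IsPolytope G) (c0 : Euc d) (x : Euc d) :
    x ∈ innerCone (maxFace G c0) G ↔
      ∀ c, maxFace G c = maxFace G c0 → ⟪(vectorSpan ℝ G).starProjection x, c⟫_ℝ ≤ 0 := by
  set F := maxFace G c0 with hF
  set M := vectorSpan ℝ G with hM
  have hFp : IsPolytope F := poly_maxFace hG c0
  have hq := relPt_mem hFp
  have hqF : relPt F ∈ F := intrinsicInterior_subset hq
  constructor
  · rintro ⟨_, ⟨r, _, ⟨p, hp, rfl⟩, hr, rfl⟩, m, hm, rfl⟩ c hc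
    have hc' : relPt F ∈ maxFace G c := hc ▸ hqF
    have h1 : M.starProjection (r • (p - relPt F) + m) = r • (p - relPt F) := by
      apply Submodule.eq_starProjection_of_mem_of_inner_eq_zero
      · exact M.smul_mem _ (vsub_mem_vectorSpan ℝ hp hqF.1)
      · intro w hw
        rw [add_sub_cancel_left]
        exact (Submodule.mem_orthogonal' _ _).1 hm w hw
    have := hc'.2 p hp
    simp only
    rw [h1, inner_smul_left, inner_sub_left, real_inner_comm, real_inner_comm c (relPt F)]
    simp only [RCLike.conj_to_real]
    nlinarith
  · intro h
    obtain ⟨T, hT⟩ := poly_h (innerCone_poly (F := F) hG)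
    rw [hT]
    intro t ht
    have hpos : ∀ u ∈ innerCone F G, 0 ≤ ⟪t, u⟫_ℝ := fun u hu => by
      rw [hT] at hu; exact hu t ht
    have hz : (0 : Euc d) ∈ posHull ((fun x => x - relPt F) '' G) :=
      ⟨0, _, ⟨relPt F, hqF.1, rfl⟩, le_rfl, by simp⟩
    have htM : t ∈ M := by
      rw [← Submodule.orthogonal_orthogonal M, Submodule.mem_orthogonal']
      intro u hu
      have h1 := hpos u ⟨0, hz, u, hu, zero_add u⟩
      have h2 := hpos (-u) ⟨0, hz, -u, Submodule.neg_mem _ hu, zero_add _⟩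
      rw [inner_neg_right] at h2
      linarith
    have hmax : ∀ p ∈ G, ⟪-t, p⟫_ℝ ≤ ⟪-t, relPt F⟫_ℝ := by
      intro p hp
      have h1 := hpos (p - relPt F) ⟨p - relPt F, ⟨1, _, ⟨p, hp, rfl⟩, zero_le_one, by simp⟩, 0,
        Submodule.zero_mem _, add_zero _⟩
      rw [inner_sub_right] at h1
      simp only [inner_neg_left]; linarith
    have hsub : maxFace G c0 ⊆ maxFace G (-t) := by
      intro y hy
      refine ⟨hy.1, fun p hp => ?_⟩
      rw [relint_const hq (fun y hy => hmax y hy.1) y hy]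
      exact hmax p hp
    have hev := maxFace_perturb hG (-t) c0
    rw [maxFace_of_between (F := F) ⟨_, hqF⟩ hsub] at hev
    have hlim : Filter.Tendsto (fun e : ℝ => ⟪M.starProjection x, -t + e • c0⟫_ℝ)
        (nhdsWithin 0 (Set.Ioi 0)) (nhds ⟪M.starProjection x, -t + (0:ℝ) • c0⟫_ℝ) :=
      (Continuous.tendsto (by fun_prop) 0).mono_left nhdsWithin_le_nhds
    have hle := le_of_tendsto hlim (hev.mono fun e he => h _ he)
    rw [zero_smul, add_zero, inner_neg_right, Submodule.inner_starProjection_left_eq_right,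
      Submodule.starProjection_eq_self_iff.2 htM, real_inner_comm] at hle
    linarith

end Part4

section Part5
variable {d : ℕ}

/-- Belt polytopes with a fixed arrangement (zero normals allowed). -/
def Belt {n : ℕ} (z : Fin n → Euc d) (P : Set (Euc d)) : Prop :=
  IsPolytope P ∧ ∀ c c', sg z c = sg z c' ↔ maxFace P c = maxFace P c'

theorem realSign_iff (a b : ℝ) : Real.sign a = Real.sign b ↔ SignType.sign a = SignType.sign b := by
  rcases lt_trichotomy a 0 with ha | ha | ha <;> rcases lt_trichotomy b 0 with hb | hb | hb <;>
    simp [ha, hb, Real.sign_of_neg, Real.sign_of_pos, sign_neg, sign_pos] <;> norm_num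

theorem belt_of {P : Set (Euc d)} (h : IsBeltPolytope P) :
    ∃ (n : ℕ) (z : Fin n → Euc d), Belt z P := by
  obtain ⟨hP, n, z, _, hz⟩ := h
  refine ⟨n, z, hP, fun c c' => ?_⟩
  rw [← hz c c', funext_iff]
  exact forall_congr' fun i => (realSign_iff _ _).symm

theorem belt_face {n : ℕ} {z : Fin n → Euc d} {P : Set (Euc d)} (hP : Belt z P) (c1 : Euc d) :
    Belt (fun i => if ⟪z i, c1⟫_ℝ = 0 then z i else 0) (maxFace P c1) := by
  refine ⟨poly_maxFace hP.1 c1, fun c c' => ?_⟩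
  have hs : ∀ w i, ⟪z i, c1⟫_ℝ ≠ 0 → ∀ᶠ t : ℝ in nhdsWithin 0 (Set.Ioi 0),
      sg z (c1 + t • w) i = sg z c1 i := by
    intro w i hi
    have := sign_eventually (a := ⟪z i, c1⟫_ℝ) ⟪z i, w⟫_ℝ (fun h => absurd h hi)
    filter_upwards [this.filter_mono nhdsWithin_le_nhds] with t ht
    simpa [sg, inner_add_right, inner_smul_right] using ht
  have hs' : ∀ w, ∀ᶠ t : ℝ in nhdsWithin 0 (Set.Ioi 0), ∀ i, ⟪z i, c1⟫_ℝ ≠ 0 →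
      sg z (c1 + t • w) i = sg z c1 i := by
    intro w
    rw [Filter.eventually_all]
    intro i
    by_cases hi : ⟪z i, c1⟫_ℝ = 0
    · exact Filter.Eventually.of_forall fun t h => absurd hi h
    · filter_upwards [hs w i hi] with t ht _ using ht
  obtain ⟨t, h1, h2, h3, h4, ht⟩ := ((hs' c).and ((hs' c').and ((maxFace_perturb hP.1 c1 c).and
    ((maxFace_perturb hP.1 c1 c').and self_mem_nhdsWithin)))).exists
  have ht : 0 < t := ht
  rw [← h3, ← h4, ← hP.2]
  simp only [funext_iff]
  refine forall_congr' fun i => ?_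
  by_cases hi : ⟪z i, c1⟫_ℝ = 0
  · simp [sg, hi, inner_add_right, inner_smul_right, sign_mul, sign_pos ht]
  · rw [h1 i hi, h2 i hi]; simp [sg, hi]

section
variable {n : ℕ} {z : Fin n → Euc d} {P : Set (Euc d)} 

theorem mem_flat_orth (hP : Belt z P) (c0 c : Euc d) : c ∈ (vectorSpan ℝ (maxFace P c0))ᗮ ↔
    ∀ i, ⟪z i, c0⟫_ℝ = 0 → ⟪z i, c⟫_ℝ = 0 := by
  constructor
  · intro h i hi
    obtain ⟨t, h1, ht⟩ := ((maxFace_perturb hP.1 c0 c).and self_mem_nhdsWithin).exists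
    have ht : 0 < t := ht
    rw [maxFace_eq_self h, ← hP.2] at h1
    have := congrFun h1 i
    simpa [sg, hi, inner_add_right, inner_smul_right, ht.ne'] using this
  · intro h
    obtain ⟨t, h1, h2⟩ := ((maxFace_perturb hP.1 c0 c).and
      ((sg_eventually z c0 c h).filter_mono nhdsWithin_le_nhds)).exists
    rw [(hP.2 _ _).1 h2] at h1
    exact mem_orth_of_maxFace h1.le

theorem z_mem_flat (hP : Belt z P) (c0 : Euc d) (i : Fin n) :
    z i ∈ vectorSpan ℝ (maxFace P c0) ↔ ⟪z i, c0⟫_ℝ = 0 := by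
  constructor
  · intro h
    exact (Submodule.mem_orthogonal _ _).1 (maxFace_orth P c0) _ h
  · intro h
    rw [← Submodule.orthogonal_orthogonal (vectorSpan ℝ (maxFace P c0)), Submodule.mem_orthogonal']
    intro u hu
    exact (mem_flat_orth hP c0 u).1 hu i h

theorem flat_le (hP : Belt z P) (c0 : Euc d) (W : Submodule ℝ (Euc d))
    (h : ∀ i, z i ∈ vectorSpan ℝ (maxFace P c0) → z i ∈ W) : vectorSpan ℝ (maxFace P c0) ≤ W := by
  rw [← Submodule.orthogonal_orthogonal (vectorSpan ℝ (maxFace P c0)),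
    ← Submodule.orthogonal_orthogonal W]
  apply Submodule.orthogonal_le
  intro c hc
  rw [mem_flat_orth hP]
  intro i hi
  exact (Submodule.mem_orthogonal _ _).1 hc _ (h i ((z_mem_flat hP c0 i).2 hi))

theorem face_sub_iff (hP : Belt z P) (c0 c : Euc d) : maxFace P c0 ⊆ maxFace P c ↔
    ∀ i, ⟪z i, c⟫_ℝ ≠ 0 → sg z c i = sg z c0 i := by
  constructor
  · intro h i hi
    have hev := maxFace_perturb hP.1 c c0
    rw [maxFace_of_between (F := P) (poly_maxFace_nonempty hP.1 _) h] at hev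
    have := sign_eventually (a := ⟪z i, c⟫_ℝ) ⟪z i, c0⟫_ℝ (fun h => absurd h hi)
    obtain ⟨t, h1, h2⟩ := (hev.and (this.filter_mono nhdsWithin_le_nhds)).exists
    rw [← hP.2] at h1
    rw [← h1]
    simpa [sg, inner_add_right, inner_smul_right] using h2.symm
  · intro h
    obtain ⟨t, h1, ht⟩ := ((maxFace_perturb hP.1 c c0).and self_mem_nhdsWithin).exists
    have ht : 0 < t := ht
    have h2 : sg z (c + t • c0) = sg z c0 := by
      funext i
      have hi := h i
      simp only [sg, inner_add_right, inner_smul_right] at hi ⊢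
      rcases lt_trichotomy ⟪z i, c⟫_ℝ 0 with h3 | h3 | h3
      · have h4 := hi h3.ne
        rw [sign_neg h3] at h4
        have h5 := sign_eq_neg_one_iff.1 h4.symm
        rw [← h4, sign_eq_neg_one_iff]
        nlinarith
      · rw [h3, zero_add, sign_mul, sign_pos ht, one_mul]
      · have h4 := hi h3.ne'
        rw [sign_pos h3] at h4
        have h5 := sign_eq_one_iff.1 h4.symm
        rw [← h4, sign_eq_one_iff]
        nlinarith
    rw [hP.2] at h2
    rw [← h2, h1]
    exact maxFace_subset _ _

end

/-- The finite set of nonempty faces. -/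
def faces {P : Set (Euc d)} (hP : IsPolytope P) : Finset (Set (Euc d)) := (faces_finite hP).toFinset

theorem mem_faces {P F : Set (Euc d)} {hP : IsPolytope P} : F ∈ faces hP ↔ ∃ c, F = maxFace P c := by
  simp [faces]

theorem mem_Flats {P : Set (Euc d)} (hP : IsPolytope P) {L : Submodule ℝ (Euc d)} :
    L ∈ Flats P ↔ ∃ c, L = vectorSpan ℝ (maxFace P c) := by
  constructor
  · rintro ⟨F, h1, h2, rfl⟩
    obtain ⟨c, rfl⟩ := (face_iff hP).1 ⟨h1, h2⟩
    exact ⟨c, rfl⟩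
  · rintro ⟨c, rfl⟩
    obtain ⟨h1, h2⟩ := (face_iff hP).2 ⟨c, rfl⟩
    exact ⟨_, h1, h2, rfl⟩

theorem Flats_finite {P : Set (Euc d)} (hP : IsPolytope P) : (Flats P).Finite := by
  refine ((faces_finite hP).image (fun F => vectorSpan ℝ F)).subset ?_
  intro L hL
  obtain ⟨c, rfl⟩ := (mem_Flats hP).1 hL
  exact ⟨_, ⟨c, rfl⟩, rfl⟩

theorem mem_outerCone {P : Set (Euc d)} (F : Set (Euc d)) (hF : F ⊆ P) (x : Euc d) :
    x ∈ outerCone F P ↔ F ⊆ maxFace P ((vectorSpan ℝ F)ᗮ.starProjection x) := by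
  constructor
  · rintro ⟨c, hc, l, hl, rfl⟩
    have h0 : F ⊆ maxFace P c := fun y hy => ⟨hF hy, fun p hp => hc y hy p hp⟩
    have h1 : (vectorSpan ℝ F)ᗮ.starProjection (c + l) = c := by
      apply Submodule.eq_starProjection_of_mem_of_inner_eq_zero
      · exact maxFace_sub_orth h0
      · intro w hw
        rw [add_sub_cancel_left]
        exact (Submodule.mem_orthogonal _ _).1 hw l hl
    simp only
    rw [h1]; exact h0
  · intro h
    refine ⟨(vectorSpan ℝ F)ᗮ.starProjection x, fun y hy p hp => (h hy).2 p hp,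
      (vectorSpan ℝ F).starProjection x, Submodule.starProjection_apply_mem _ _, ?_⟩
    simp only
    rw [add_comm]
    exact Submodule.starProjection_add_starProjection_orthogonal x

open Classical in
theorem ext_sum {n : ℕ} {z : Fin n → Euc d} {P : Set (Euc d)} (hP : Belt z P) (α : ConeAngle d)
    (L : Submodule ℝ (Euc d)) (hL : L ∈ Flats P) :
    ∑ F ∈ (faces hP.1).filter (fun F => vectorSpan ℝ F = L), extAngle α F P = 1 := by
  obtain ⟨c2, hc2⟩ := (mem_Flats hP.1).1 hL
  refine additivity α _ (fun F => outerCone F P) ?_ 1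
    ((Finset.univ.filter (fun i => z i ∉ L)).image (fun i => Lᗮ.starProjection (z i))) ?_ ?_
  · intro F hF
    obtain ⟨c, rfl⟩ := mem_faces.1 (Finset.mem_filter.1 hF).1
    exact outerCone_poly (poly_maxFace hP.1 c) hP.1
  · intro a ha h0
    obtain ⟨i, hi, rfl⟩ := Finset.mem_image.1 ha
    apply (Finset.mem_filter.1 hi).2
    have := (Submodule.starProjection_apply_eq_zero_iff (K := Lᗮ) (v := z i)).1 h0
    rwa [Submodule.orthogonal_orthogonal] at this
  · intro x hx
    set y := Lᗮ.starProjection x with hy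
    have hyL : y ∈ Lᗮ := Submodule.starProjection_apply_mem _ _
    have hzy : ∀ i, ⟪z i, y⟫_ℝ = 0 ↔ z i ∈ L := by
      intro i
      constructor
      · intro h
        by_contra hi
        apply hx (Lᗮ.starProjection (z i)) (Finset.mem_image.2 ⟨i, by simp [hi], rfl⟩)
        rw [Submodule.inner_starProjection_left_eq_right]; exact h
      · intro h
        exact (Submodule.mem_orthogonal _ _).1 hyL _ h
    have hFy : vectorSpan ℝ (maxFace P y) = L := by
      apply le_antisymm
      · apply flat_le hP
        intro i hi
        exact (hzy i).1 ((z_mem_flat hP y i).1 hi)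
      · rw [hc2]
        apply flat_le hP
        intro i hi
        rw [← hc2] at hi
        exact (z_mem_flat hP y i).2 ((hzy i).2 hi)
    have : ((faces hP.1).filter (fun F => vectorSpan ℝ F = L)).filter (fun F => x ∈ outerCone F P)
        = {maxFace P y} := by
      ext F
      simp only [Finset.mem_filter, Finset.mem_singleton, mem_faces]
      constructor
      · rintro ⟨⟨⟨c, rfl⟩, hc⟩, hxO⟩
        rw [mem_outerCone _ (maxFace_subset _ _), hc, ← hy, face_sub_iff hP] at hxO
        rw [← hP.2]
        funext i
        by_cases hi : ⟪z i, y⟫_ℝ = 0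
        · have h1 : z i ∈ vectorSpan ℝ (maxFace P c) := by rw [hc]; exact (hzy i).1 hi
          simp [sg, hi, (z_mem_flat hP c i).1 h1]
        · exact (hxO i hi).symm
      · rintro rfl
        refine ⟨⟨⟨y, rfl⟩, hFy⟩, ?_⟩
        rw [mem_outerCone _ (maxFace_subset _ _), hFy]
    rw [this]; simp

end Part5

section Part6
variable {d : ℕ}

theorem parity_sub {l m : ℕ} (h : l ≤ m) : (-1 : ℝ) ^ (m - l) = (-1) ^ (m + l) := by
  have : m + l = (m - l) + 2 * l := by omega
  rw [this, pow_add, pow_mul]; simp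

theorem parity_sq (l : ℕ) : (-1 : ℝ) ^ l * (-1) ^ l = 1 := by
  rw [← mul_pow]; simp

open Classical in
/-- Euler-type count of tangent cones containing `x`. -/
theorem inner_euler {n : ℕ} {z : Fin n → Euc d} {P : Set (Euc d)} (hP : Belt z P) (c1 : Euc d)
    (a : Submodule ℝ (Euc d)) (ha : a ∈ Flats P) (haM : a ≤ vectorSpan ℝ (maxFace P c1)) (x : Euc d) :
    ∑ F ∈ (faces (poly_maxFace hP.1 c1)).filter
        (fun F => a ≤ vectorSpan ℝ F ∧ x ∈ innerCone F (maxFace P c1)),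
      (-1 : ℝ) ^ (d + sdim F)
    = if (vectorSpan ℝ (maxFace P c1)).starProjection x ∈ a then
        (-1) ^ (d + Module.finrank ℝ a) else 0 := by
  set G := maxFace P c1 with hGdef
  set M := vectorSpan ℝ G with hM
  have hG := belt_face hP c1
  set z' : Fin n → Euc d := fun i => if ⟪z i, c1⟫_ℝ = 0 then z i else 0 with hz'
  have hfr : ∀ W : Submodule ℝ (Euc d), (-1 : ℝ) ^ Module.finrank ℝ Wᗮ = (-1) ^ (d + Module.finrank ℝ W) := by
    intro W
    have h1 := Submodule.finrank_add_finrank_orthogonal W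
    rw [finrank_euclideanSpace_fin] at h1
    rw [← parity_sub (by omega)]
    congr 1; omega
  -- flats and cells
  have hcell : ∀ c, c ∈ aᗮ → a ≤ vectorSpan ℝ (maxFace G c) := by
    intro c hc
    obtain ⟨c2, rfl⟩ := (mem_Flats hP.1).1 ha
    apply flat_le hP
    intro i hi
    have h1 : ⟪z i, c1⟫_ℝ = 0 := (z_mem_flat hP c1 i).1 (haM hi)
    have h2 : z' i = z i := by simp [hz', h1]
    rw [← h2, z_mem_flat hG, h2]
    exact (Submodule.mem_orthogonal _ _).1 hc _ hi
  have hcell' : ∀ c, a ≤ vectorSpan ℝ (maxFace G c) → c ∈ aᗮ := fun c h =>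
    Submodule.orthogonal_le h (maxFace_orth G c)
  have hE := euler_sum aᗮ (M.starProjection x) n z'
  have hrhs : (∀ c ∈ aᗮ, ⟪M.starProjection x, c⟫_ℝ = 0) ↔ M.starProjection x ∈ a := by
    rw [← Submodule.mem_orthogonal', Submodule.orthogonal_orthogonal]
  simp only [hrhs] at hE
  rw [hfr] at hE
  rw [← hE, ← Finset.sum_filter]
  have hch : ∀ F ∈ (faces (poly_maxFace hP.1 c1)).filter
        (fun F => a ≤ vectorSpan ℝ F ∧ x ∈ innerCone F (maxFace P c1)), ∃ c, F = maxFace G c :=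
    fun F hF => mem_faces.1 (Finset.mem_filter.1 hF).1
  refine Finset.sum_bij (fun F hF => sg z' (hch F hF).choose) ?_ ?_ ?_ ?_
  · intro F hF
    have hc := (hch F hF).choose_spec
    set c := (hch F hF).choose
    obtain ⟨_, h1, h2⟩ := Finset.mem_filter.1 hF
    rw [hc] at h1 h2
    rw [mem_innerCone hG.1] at h2
    rw [Finset.mem_filter]
    refine ⟨Finset.mem_univ _, ⟨c, hcell' c h1, rfl⟩, fun c' _ h => h2 c' ((hG.2 _ _).1 h)⟩
  · intro F hF F' hF' h
    rw [(hch F hF).choose_spec, (hch F' hF').choose_spec]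
    exact (hG.2 _ _).1 h
  · intro ε hε
    obtain ⟨_, ⟨c, hc, rfl⟩, h2⟩ := Finset.mem_filter.1 hε
    have hm : maxFace G c ∈ (faces (poly_maxFace hP.1 c1)).filter
        (fun F => a ≤ vectorSpan ℝ F ∧ x ∈ innerCone F (maxFace P c1)) := by
      rw [Finset.mem_filter]
      refine ⟨mem_faces.2 ⟨c, rfl⟩, hcell c hc, ?_⟩
      rw [mem_innerCone hG.1]
      intro c' hc'
      exact h2 c' (hcell' c' (by rw [hc']; exact hcell c hc)) ((hG.2 _ _).2 hc')
    refine ⟨_, hm, ?_⟩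
    exact (hG.2 _ _).2 (hch _ hm).choose_spec.symm
  · intro F hF
    have hc := (hch F hF).choose_spec
    set c := (hch F hF).choose
    obtain ⟨_, h1, h2⟩ := Finset.mem_filter.1 hF
    have : wsub aᗮ z' (sg z' c) = (vectorSpan ℝ F)ᗮ := by
      ext w
      rw [mem_wsub, hc, mem_flat_orth hG]
      constructor
      · rintro ⟨_, h⟩ i hi
        exact h i (by simp [sg, hi])
      · intro h
        refine ⟨Submodule.orthogonal_le (hc ▸ h1) ((mem_flat_orth hG c w).2 h), fun i hi => h i ?_⟩
        simpa [sg] using hi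
    rw [this, hfr]
    rfl

open Classical in
/-- Sum of interior angles over the faces of a face with a fixed flat. -/
theorem int_sum {n : ℕ} {z : Fin n → Euc d} {P : Set (Euc d)} (hP : Belt z P) (α : ConeAngle d)
    (c1 : Euc d) (M L : ↥(Flats P)) (hM : M.1 = vectorSpan ℝ (maxFace P c1)) (hLM : L ≤ M) :
    ∑ F ∈ (faces (poly_maxFace hP.1 c1)).filter (fun F => vectorSpan ℝ F = L.1),
        intAngle α F (maxFace P c1)
      = (-1 : ℝ) ^ (Module.finrank ℝ M.1 + Module.finrank ℝ L.1) * mob L M ∧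
    0 ≤ (-1 : ℝ) ^ (Module.finrank ℝ M.1 + Module.finrank ℝ L.1) * mob L M := by
  haveI : Fintype ↥(Flats P) := (Flats_finite hP.1).fintype
  have hb : ∀ a : ↥(Flats P), ∃ b : Euc d, b ≠ 0 ∧ (a < M → b ∈ M.1 ∧ b ∈ a.1ᗮ) ∨ ¬ a < M := by
    intro a
    by_cases h : a < M
    · have h' : a.1 < M.1 := h
      have h1 : a.1ᗮ ⊓ M.1 ≠ ⊥ := by
        intro h2
        have := Submodule.sup_orthogonal_inf_of_hasOrthogonalProjection h'.le
        rw [h2, sup_bot_eq] at this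
        exact h'.ne this
      obtain ⟨b, hb, hb0⟩ := Submodule.exists_mem_ne_zero_of_ne_bot h1
      exact ⟨b, Or.inl ⟨hb0, fun _ => ⟨hb.2, hb.1⟩⟩⟩
    · exact ⟨0, Or.inr h⟩
  choose b hb using hb
  set bad := (Finset.univ.filter (fun a : ↥(Flats P) => a < M)).image b with hbad
  have hbad0 : ∀ v ∈ bad, v ≠ 0 := by
    intro v hv
    obtain ⟨a, ha, rfl⟩ := Finset.mem_image.1 hv
    have ha := (Finset.mem_filter.1 ha).2
    rcases hb a with h | h
    · exact h.1
    · exact absurd ha h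
  have hcount : ∀ x, (∀ v ∈ bad, ⟪v, x⟫_ℝ ≠ 0) →
      ((((faces (poly_maxFace hP.1 c1)).filter (fun F => vectorSpan ℝ F = L.1)).filter
        (fun F => x ∈ innerCone F (maxFace P c1))).card : ℝ)
      = (-1 : ℝ) ^ (Module.finrank ℝ M.1 + Module.finrank ℝ L.1) * mob L M := by
    intro x hx
    set f : ↥(Flats P) → Finset (Set (Euc d)) := fun L =>
      ((faces (poly_maxFace hP.1 c1)).filter (fun F => vectorSpan ℝ F = L.1)).filter
        (fun F => x ∈ innerCone F (maxFace P c1)) with hf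
    have hmob := mob_unique M (fun K => (-1 : ℝ) ^ (Module.finrank ℝ M.1 + Module.finrank ℝ K.1) * ((f K).card : ℝ))
      ?_ L hLM
    · rw [← hmob, ← mul_assoc, parity_sq, one_mul]
    · intro a haM
      have hE := inner_euler hP c1 a.1 a.2 (hM ▸ haM) x
      have hy : (vectorSpan ℝ (maxFace P c1)).starProjection x ∈ a.1 ↔ a = M := by
        constructor
        · intro h
          by_contra hne
          have hlt : a < M := lt_of_le_of_ne haM hne
          rcases hb a with h1 | h1
          · apply hx (b a) (Finset.mem_image.2 ⟨a, by simp [hlt], rfl⟩)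
            obtain ⟨h2, h3⟩ := h1.2 hlt
            rw [hM] at h2
            rw [← Submodule.starProjection_eq_self_iff.2 h2, Submodule.inner_starProjection_left_eq_right]
            exact (Submodule.mem_orthogonal' _ _).1 h3 _ h
          · exact h1 hlt
        · rintro rfl
          rw [hM]; exact Submodule.starProjection_apply_mem _ _
      have hlhs : ∑ F ∈ (faces (poly_maxFace hP.1 c1)).filter
            (fun F => a.1 ≤ vectorSpan ℝ F ∧ x ∈ innerCone F (maxFace P c1)), (-1 : ℝ) ^ (d + sdim F)
          = ∑ K ∈ Finset.univ.filter (fun K : ↥(Flats P) => a ≤ K ∧ K ≤ M),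
              (-1 : ℝ) ^ (d + Module.finrank ℝ K.1) * ((f K).card : ℝ) := by
        have hbi : (faces (poly_maxFace hP.1 c1)).filter
            (fun F => a.1 ≤ vectorSpan ℝ F ∧ x ∈ innerCone F (maxFace P c1))
            = (Finset.univ.filter (fun K : ↥(Flats P) => a ≤ K ∧ K ≤ M)).biUnion f := by
          ext F
          simp only [Finset.mem_filter, Finset.mem_biUnion, Finset.mem_univ, true_and, hf]
          constructor
          · rintro ⟨hF, h1, h2⟩
            obtain ⟨c, rfl⟩ := mem_faces.1 hF
            have hK : vectorSpan ℝ (maxFace (maxFace P c1) c) ∈ Flats P := by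
              obtain ⟨t, ht⟩ := (maxFace_perturb hP.1 c1 c).exists
              exact (mem_Flats hP.1).2 ⟨_, by rw [← ht]⟩
            refine ⟨⟨_, hK⟩, ⟨h1, ?_⟩, ⟨hF, rfl⟩, h2⟩
            show vectorSpan ℝ _ ≤ M.1
            rw [hM]
            exact vectorSpan_mono ℝ (maxFace_subset _ _)
          · rintro ⟨K, ⟨h1, h2⟩, ⟨h3, h4⟩, h5⟩
            exact ⟨h3, h4 ▸ h1, h5⟩
        rw [hbi, Finset.sum_biUnion]
        · refine Finset.sum_congr rfl fun K _ => ?_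
          rw [mul_comm, ← nsmul_eq_mul, ← Finset.sum_const]
          refine Finset.sum_congr rfl fun F hF => ?_
          simp only [hf, Finset.mem_filter] at hF
          rw [sdim, hF.1.2]
        · intro K _ K' _ hne
          refine Finset.disjoint_left.2 fun F h1 h2 => hne ?_
          simp only [hf, Finset.mem_filter] at h1 h2
          exact Subtype.ext (h1.1.2.symm.trans h2.1.2)
      rw [hlhs] at hE
      simp only [hy] at hE
      have hE2 := congrArg (fun r => (-1 : ℝ) ^ (d + Module.finrank ℝ M.1) * r) hE
      simp only [Finset.mul_sum] at hE2
      have hsw : ∀ l m : ℕ, (-1 : ℝ) ^ (d + m) * (-1) ^ (d + l) = (-1) ^ (m + l) := by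
        intro l m
        rw [pow_add, pow_add, pow_add]
        calc _ = ((-1 : ℝ) ^ d * (-1) ^ d) * ((-1) ^ m * (-1) ^ l) := by ring
          _ = _ := by rw [parity_sq, one_mul]
      simp only [← mul_assoc, hsw] at hE2
      rw [hE2]
      split_ifs with h
      · rw [h]; exact parity_sq _
      · simp
  refine ⟨?_, ?_⟩
  · refine additivity α _ (fun F => innerCone F (maxFace P c1)) ?_ _ bad hbad0 hcount
    intro F hF
    exact innerCone_poly (poly_maxFace hP.1 c1)
  · obtain ⟨x, hx⟩ := exists_generic bad hbad0
    rw [← hcount x hx]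
    positivity

end Part6

section Part7
variable {d : ℕ}

open Classical in
theorem finsum_set_eq {β : Type*} [Fintype β] (p : β → Prop) (f : β → ℝ) :
    ∑ᶠ a ∈ {a : β | p a}, f a = ∑ a ∈ Finset.univ.filter p, f a := by
  have : {a : β | p a} = ((Finset.univ.filter p : Finset β) : Set β) := by ext; simp
  rw [this, finsum_mem_coe_finset]

open Classical in
theorem finsum_faces {P : Set (Euc d)} (hP : IsPolytope P) (k : ℕ) (φ : Set (Euc d) → ℝ) :
    ∑ᶠ F ∈ {F : Set (Euc d) | IsFace P F ∧ F.Nonempty ∧ sdim F = k}, φ F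
      = ∑ F ∈ (faces hP).filter (fun F => sdim F = k), φ F := by
  have : {F : Set (Euc d) | IsFace P F ∧ F.Nonempty ∧ sdim F = k}
      = (((faces hP).filter (fun F => sdim F = k) : Finset (Set (Euc d))) : Set (Set (Euc d))) := by
    ext F
    simp only [Set.mem_setOf_eq, Finset.coe_filter, mem_faces, ← face_iff hP, and_assoc]
  rw [this, finsum_mem_coe_finset]

open Classical in
theorem group_sum {P : Set (Euc d)} (hP : IsPolytope P) [Fintype ↥(Flats P)] (k : ℕ)
    (φ : Set (Euc d) → ℝ) :
    ∑ F ∈ (faces hP).filter (fun F => sdim F = k), φ F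
      = ∑ L ∈ Finset.univ.filter (fun L : ↥(Flats P) => Module.finrank ℝ L.1 = k),
          ∑ F ∈ (faces hP).filter (fun F => vectorSpan ℝ F = L.1), φ F := by
  rw [← Finset.sum_biUnion]
  · refine Finset.sum_congr ?_ fun _ _ => rfl
    ext F
    simp only [Finset.mem_filter, Finset.mem_biUnion, Finset.mem_univ, true_and]
    constructor
    · rintro ⟨hF, h⟩
      obtain ⟨c, rfl⟩ := mem_faces.1 hF
      exact ⟨⟨_, (mem_Flats hP).2 ⟨c, rfl⟩⟩, h, hF, rfl⟩
    · rintro ⟨L, h1, h2, h3⟩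
      exact ⟨h2, by rw [sdim, h3, h1]⟩
  · intro K _ K' _ hne
    refine Finset.disjoint_left.2 fun F h1 h2 => hne ?_
    simp only [Finset.mem_filter] at h1 h2
    exact Subtype.ext (h1.2.symm.trans h2.2)

theorem maxFace_zero (P : Set (Euc d)) : maxFace P 0 = P := by
  ext x; simp [maxFace]

open Classical in
theorem vertex_sum {P : Set (Euc d)} (hP : IsPolytope P) (V : Finset (Euc d))
    (hV : ∀ v, v ∈ V ↔ IsFace P {v}) (c1 : Euc d) (φ : Set (Euc d) → ℝ) :
    ∑ v ∈ V.filter (fun v => v ∈ maxFace P c1), φ {v}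
      = ∑ F ∈ (faces (poly_maxFace hP c1)).filter (fun F => vectorSpan ℝ F = ⊥), φ F := by
  refine Finset.sum_bij (fun v _ => ({v} : Set (Euc d))) ?_ ?_ ?_ ?_
  · intro v hv
    obtain ⟨h1, h2⟩ := Finset.mem_filter.1 hv
    rw [hV] at h1
    obtain ⟨c, hc⟩ := (face_iff hP).1 ⟨h1, Set.singleton_nonempty v⟩
    have hvc : v ∈ maxFace P c := hc ▸ Set.mem_singleton v
    rw [Finset.mem_filter]
    refine ⟨mem_faces.2 ⟨c, ?_⟩, vectorSpan_singleton ℝ v⟩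
    apply Set.Subset.antisymm
    · rintro _ rfl
      exact ⟨h2, fun y hy => hvc.2 y hy.1⟩
    · intro y hy
      rw [hc]
      exact ⟨hy.1.1, fun u hu => (hvc.2 u hu).trans (hy.2 v h2)⟩
  · intro v _ v' _ h
    exact Set.singleton_injective h
  · intro F hF
    obtain ⟨h1, h2⟩ := Finset.mem_filter.1 hF
    obtain ⟨c, rfl⟩ := mem_faces.1 h1
    obtain ⟨v, hv⟩ := poly_maxFace_nonempty (poly_maxFace hP c1) c
    have hs := (vectorSpan_eq_bot_iff_subsingleton (k := ℝ)).1 h2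
    have he : maxFace (maxFace P c1) c = {v} := hs.eq_singleton_of_mem hv
    obtain ⟨t, ht⟩ := (maxFace_perturb hP c1 c).exists
    refine ⟨v, ?_, he.symm⟩
    rw [Finset.mem_filter, hV]
    exact ⟨((face_iff hP).2 ⟨_, he.symm.trans ht.symm⟩).1, hv.1⟩
  · intro v _; rfl

open Classical in
theorem sphVol_eq {P : Set (Euc d)} (hP : IsPolytope P) (α : ConeAngle d) (k : ℕ)
    (φ : Submodule ℝ (Euc d) → ℝ)
    (h : ∀ c1, ∑ F ∈ (faces (poly_maxFace hP c1)).filter (fun F => vectorSpan ℝ F = ⊥),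
      intAngle α F (maxFace P c1) = φ (vectorSpan ℝ (maxFace P c1))) :
    sphVol α P k = ∑ F ∈ (faces hP).filter (fun F => sdim F = k),
      φ (vectorSpan ℝ F) * extAngle α F P := by
  have hfin : {v : Euc d | IsFace P {v}}.Finite := by
    refine Set.Finite.of_finite_image ((faces_finite hP).subset ?_)
      (f := fun v => ({v} : Set (Euc d))) (Set.singleton_injective.injOn)
    rintro _ ⟨v, hv, rfl⟩
    exact (face_iff hP).1 ⟨hv, Set.singleton_nonempty v⟩
  have hV : ∀ v, v ∈ hfin.toFinset ↔ IsFace P {v} := by intro v; simp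
  set V := hfin.toFinset
  have hset : {p : Euc d × Set (Euc d) | IsFace P {p.1} ∧ IsFace P p.2 ∧ p.2.Nonempty ∧
      sdim p.2 = k ∧ p.1 ∈ p.2}
      = (((V ×ˢ (faces hP).filter (fun F => sdim F = k)).filter (fun p => p.1 ∈ p.2) :
        Finset (Euc d × Set (Euc d))) : Set _) := by
    ext p
    simp only [Set.mem_setOf_eq, Finset.coe_filter, Finset.mem_product, Finset.mem_filter, hV,
      mem_faces, ← face_iff hP, and_assoc]
  unfold sphVol
  rw [hset, finsum_mem_coe_finset, Finset.sum_filter, Finset.sum_product_right]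
  refine Finset.sum_congr rfl fun F hF => ?_
  obtain ⟨c1, rfl⟩ := mem_faces.1 (Finset.mem_filter.1 hF).1
  rw [← Finset.sum_filter]
  simp only
  rw [← Finset.sum_mul,
    vertex_sum hP V hV c1 (fun F => intAngle α F (maxFace P c1)), h c1]

end Part7

/-- Corollary 4.6, Klivans–Swartz type relations.
For a cone angle `α` and a `d`-dimensional belt polytope `P` with lattice of flats
`L(P)` (with minimum `bot = {0}` and maximum `top = ℝ^d`), for `0 ≤ k < d`:
(i) `α̌_k(P) = W_k(L(P))`;
(ii) `α̂_k(P) = (-1)^{d-k} w_{d-k}(L(P)^op) = |w_{d-k}(L(P)^op)|`;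
(iii) `ᾱ_k(P) = (-1)^k w_k(L(P)) = |w_k(L(P))|`. -/
theorem statement9 (d : ℕ) (hd : 0 < d) (α : ConeAngle d) (P : Set (Euc d))
    (hP : IsBeltPolytope P) (hdim : sdim P = d)
    (bot top : ↥(Flats P)) (hbot : bot.1 = ⊥) (htop : top.1 = vectorSpan ℝ P)
    (k : ℕ) (hk : k < d) :
    extAngleSum α P k = (Nat.card {L : ↥(Flats P) // Module.finrank ℝ L.1 = k} : ℝ) ∧
    (intAngleSum α P k = (-1) ^ (d - k) *
        whitney1 (β := (↥(Flats P))ᵒᵈ)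
          (fun L => d - Module.finrank ℝ (OrderDual.ofDual L).1)
          (OrderDual.toDual top) (d - k) ∧
      intAngleSum α P k =
        |whitney1 (β := (↥(Flats P))ᵒᵈ)
          (fun L => d - Module.finrank ℝ (OrderDual.ofDual L).1)
          (OrderDual.toDual top) (d - k)|) ∧
    (sphVol α P k = (-1) ^ k *
        whitney1 (fun L : ↥(Flats P) => Module.finrank ℝ L.1) bot k ∧
      sphVol α P k =
        |whitney1 (fun L : ↥(Flats P) => Module.finrank ℝ L.1) bot k|) := by
  classical
  obtain ⟨n, z, hB⟩ := belt_of hP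
  haveI : Fintype ↥(Flats P) := (Flats_finite hB.1).fintype
  have hlebot : ∀ L : ↥(Flats P), bot ≤ L := fun L => by
    show bot.1 ≤ L.1
    rw [hbot]; exact bot_le
  have hletop : ∀ L : ↥(Flats P), L ≤ top := fun L => by
    obtain ⟨c, hc⟩ := (mem_Flats hB.1).1 L.2
    show L.1 ≤ top.1
    rw [htop, hc]
    exact vectorSpan_mono ℝ (maxFace_subset _ _)
  have htopd : Module.finrank ℝ top.1 = d := by rw [htop]; exact hdim
  have hrk : ∀ L : ↥(Flats P), Module.finrank ℝ L.1 ≤ d := fun L => by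
    have := Submodule.finrank_le L.1
    rwa [finrank_euclideanSpace_fin] at this
  refine ⟨?_, ?_, ?_⟩
  · unfold extAngleSum
    rw [finsum_faces hB.1, group_sum hB.1,
      Finset.sum_congr rfl (fun L _ => ext_sum hB α L.1 L.2)]
    rw [Nat.card_eq_fintype_card, Fintype.card_subtype]
    simp
  · have hI : intAngleSum α P k = ∑ L ∈ Finset.univ.filter
        (fun L : ↥(Flats P) => Module.finrank ℝ L.1 = k), (-1) ^ (d - k) * mob L top := by
      unfold intAngleSum
      rw [finsum_faces hB.1, group_sum hB.1]
      refine Finset.sum_congr rfl fun L hL => ?_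
      have hL := (Finset.mem_filter.1 hL).2
      have := (int_sum hB α 0 top L (by rw [maxFace_zero, htop]) (hletop L)).1
      simp only [maxFace_zero] at this
      rw [this, htopd, hL, parity_sub hk.le]
    have hnn : 0 ≤ intAngleSum α P k := by
      rw [hI]
      refine Finset.sum_nonneg fun L hL => ?_
      have hL := (Finset.mem_filter.1 hL).2
      have := (int_sum hB α 0 top L (by rw [maxFace_zero, htop]) (hletop L)).2
      rwa [htopd, hL, ← parity_sub hk.le] at this
    have hw : whitney1 (β := (↥(Flats P))ᵒᵈ)
          (fun L => d - Module.finrank ℝ (OrderDual.ofDual L).1)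
          (OrderDual.toDual top) (d - k) = ∑ L ∈ Finset.univ.filter
        (fun L : ↥(Flats P) => Module.finrank ℝ L.1 = k), mob L top := by
      have h1 : whitney1 (β := (↥(Flats P))ᵒᵈ)
          (fun L => d - Module.finrank ℝ (OrderDual.ofDual L).1)
          (OrderDual.toDual top) (d - k)
          = ∑ᶠ L ∈ {L : ↥(Flats P) | d - Module.finrank ℝ L.1 = d - k},
            mob (OrderDual.toDual top) (OrderDual.toDual L) := rfl
      rw [h1, finsum_set_eq]
      refine Finset.sum_congr ?_ fun L _ => mob_dual L top
      ext L
      have := hrk L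
      simp only [Finset.mem_filter, Finset.mem_univ, true_and]
      omega
    rw [← Finset.mul_sum, ← hw] at hI
    refine ⟨hI, ?_⟩
    rw [← abs_of_nonneg hnn, hI, abs_mul, abs_pow, abs_neg, abs_one, one_pow, one_mul]
  · have hS : sphVol α P k = ∑ L ∈ Finset.univ.filter
        (fun L : ↥(Flats P) => Module.finrank ℝ L.1 = k), (-1) ^ k * mob bot L := by
      rw [sphVol_eq hB.1 α k (fun L => if h : L ∈ Flats P then
        (-1 : ℝ) ^ (Module.finrank ℝ L) * mob bot ⟨L, h⟩ else 0), group_sum hB.1]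
      · refine Finset.sum_congr rfl fun L hL => ?_
        have hL := (Finset.mem_filter.1 hL).2
        calc _ = ∑ F ∈ (faces hB.1).filter (fun F => vectorSpan ℝ F = L.1),
              ((-1) ^ k * mob bot L) * extAngle α F P := by
              refine Finset.sum_congr rfl fun F hF => ?_
              have hF := (Finset.mem_filter.1 hF).2
              rw [hF, dif_pos L.2, hL]
          _ = _ := by rw [← Finset.mul_sum, ext_sum hB α L.1 L.2, mul_one]
      · intro c1
        have hm : vectorSpan ℝ (maxFace P c1) ∈ Flats P := (mem_Flats hB.1).2 ⟨c1, rfl⟩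
        have := (int_sum hB α c1 ⟨_, hm⟩ bot rfl (hlebot _)).1
        rw [hbot] at this
        rw [this, dif_pos hm, finrank_bot, add_zero]
    have hnn : 0 ≤ sphVol α P k := by
      rw [hS]
      refine Finset.sum_nonneg fun L hL => ?_
      have hL := (Finset.mem_filter.1 hL).2
      obtain ⟨c1, hc1⟩ := (mem_Flats hB.1).1 L.2
      have := (int_sum hB α c1 L bot hc1 (hlebot _)).2
      rwa [hbot, finrank_bot, add_zero, hL] at this
    have hw : whitney1 (fun L : ↥(Flats P) => Module.finrank ℝ L.1) bot k = ∑ L ∈ Finset.univ.filter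
        (fun L : ↥(Flats P) => Module.finrank ℝ L.1 = k), mob bot L := by
      unfold whitney1
      rw [finsum_set_eq]
      exact Finset.sum_congr (by ext; simp) fun _ _ => rfl
    rw [← Finset.mul_sum, ← hw] at hS
    refine ⟨hS, ?_⟩
    rw [← abs_of_nonneg hnn, hS, abs_mul, abs_pow, abs_neg, abs_one, one_pow, one_mul]

end GramAngles
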